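/- Let n ≥ 2, let p,q ∈ ℝⁿ, let v,w ∈ ℝⁿ be unit vectors, let Λ > 0, and let γ : [0,L] → ℝⁿ be a unit-speed curve of minimal length in the class C(p,q;v,w;Λ). If κγ(s₀) < Λ for some s₀ ∈ [0,L], then there exist a₀, b₀ with s₀ ∈ [a₀,b₀] ⊆ [0,L] and a₀ ≤ c ≤ d ≤ b₀ such that γ restricted to [a₀,b₀] is a CLC(Λ) curve with data a₀ ≤ c ≤ d ≤ b₀ (line segment on [c,d], circular arcs of radius 1/Λ on [a₀,c] and [d,b₀]), and moreover (a₀ = 0 or c − a₀ ≥ π/Λ) and (b₀ = L or b₀ − d ≥ π/Λ). -/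

import Mathlib

open Set Filter MeasureTheory
open scoped RealInnerProductSpace Topology ENNReal

noncomputable section

/-- Euclidean space `ℝⁿ`. -/
abbrev Euc (n : ℕ) := EuclideanSpace ℝ (Fin n)

/-- Generalized curvature `κγ(s)` of a curve with derivative `γd` and parameter domain `D`:
the limsup, as `x, y → s` with `x ≠ y`, of `∠(γd x, γd y) / |x - y|`, expressed as the
infimum of all eventual bounds. -/
def curvAt {n : ℕ} (γd : ℝ → Euc n) (D : Set ℝ) (s : ℝ) : ℝ :=
  sInf {Λ : ℝ | 0 ≤ Λ ∧ ∃ δ > 0, ∀ x ∈ D, ∀ y ∈ D, x ≠ y →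
    |x - s| < δ → |y - s| < δ →
    InnerProductGeometry.angle (γd x) (γd y) ≤ Λ * |x - y|}

/-- `κγ(s) < Λ`: there are `δ > 0` and `Λ' < Λ` bounding the angle dilation near `s`. -/
def CurvLt {n : ℕ} (γd : ℝ → Euc n) (D : Set ℝ) (s Λ : ℝ) : Prop :=
  ∃ δ > 0, ∃ Λ' < Λ, ∀ x ∈ D, ∀ y ∈ D, x ≠ y → |x - s| < δ → |y - s| < δ →
    InnerProductGeometry.angle (γd x) (γd y) ≤ Λ' * |x - y|

/-- `f` restricted to `[a, c]` is a planar circular arc of radius `1/Λ`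
of length in `[0, 2π/Λ)`. -/
def IsArc {n : ℕ} (Λ : ℝ) (f : ℝ → Euc n) (a c : ℝ) : Prop :=
  c - a < 2 * Real.pi / Λ ∧
  ∃ (o u e : Euc n) (s₁ : ℝ), ‖u‖ = 1 ∧ ‖e‖ = 1 ∧ ⟪u, e⟫ = 0 ∧
    ∀ s ∈ Icc a c,
      f s = o + (Λ⁻¹ * Real.cos (Λ * (s - s₁))) • u + (Λ⁻¹ * Real.sin (Λ * (s - s₁))) • e

/-- `f` restricted to `[a, c]` is a planar circular arc of radius `r`. -/
def IsArcR {n : ℕ} (r : ℝ) (f : ℝ → Euc n) (a c : ℝ) : Prop :=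
  ∃ (o u e : Euc n) (s₁ : ℝ), ‖u‖ = 1 ∧ ‖e‖ = 1 ∧ ⟪u, e⟫ = 0 ∧
    ∀ s ∈ Icc a c,
      f s = o + (r * Real.cos ((s - s₁) / r)) • u + (r * Real.sin ((s - s₁) / r)) • e

/-- `O_p(v, r)`: the union of the open balls of radius `r` tangent to `v^⊥` at `p`. -/
def Odisk {n : ℕ} (p v : Euc n) (r : ℝ) : Set (Euc n) :=
  {x | ∃ w : Euc n, ‖w‖ = 1 ∧ ⟪w, v⟫ = 0 ∧ ‖x - p - r • w‖ < r}

/-- Ball radius `R_O` of the curve `f` (with derivative/tangent field `γd`) on domain `D`. -/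
def RO {n : ℕ} (f γd : ℝ → Euc n) (D : Set ℝ) : ℝ :=
  sInf {r : ℝ | 0 < r ∧ ∃ s ∈ D, ∃ t ∈ D, ∃ w : Euc n,
    ‖w‖ = 1 ∧ ⟪w, γd s⟫ = 0 ∧ ‖f t - f s - r • w‖ < r}

/-- Minimal double critical distance of the curve `f` with tangent field `γd`. -/
def MDC {n : ℕ} (f γd : ℝ → Euc n) : ℝ :=
  sInf {d : ℝ | ∃ x y : ℝ, f x ≠ f y ∧ ⟪f x - f y, γd x⟫ = 0 ∧
    ⟪f x - f y, γd y⟫ = 0 ∧ d = ‖f x - f y‖}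

/-- Normal injectivity radius `i(K, ℝⁿ)` of the curve `f` with tangent field `γd`. -/
def injRad {n : ℕ} (f γd : ℝ → Euc n) : ℝ :=
  sSup ({0} ∪ {r : ℝ | 0 < r ∧ ∀ s t : ℝ, ∀ u w : Euc n,
    ⟪u, γd s⟫ = 0 → ⟪w, γd t⟫ = 0 → ‖u‖ < r → ‖w‖ < r →
    f s + u = f t + w → f s = f t ∧ u = w})

/-- A knot: a simple closed unit-speed `C^{1,1}` curve, as an `L`-periodic map `ℝ → ℝⁿ`,
injective on `[0, L)`, with `‖γ'‖ ≡ 1` and `γ'` Lipschitz. -/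
structure Knot (n : ℕ) where
  L : ℝ
  Lpos : 0 < L
  f : ℝ → Euc n
  fd : ℝ → Euc n
  per : ∀ s, f (s + L) = f s
  perd : ∀ s, fd (s + L) = fd s
  deriv : ∀ s, HasDerivAt f (fd s) s
  unit : ∀ s, ‖fd s‖ = 1
  lipd : ∃ C : NNReal, LipschitzWith C fd
  inj : InjOn f (Ico 0 L)

/-- Ropelength `ℓ_e(γ) = L / R_O(K)`. -/
def Knot.ropelength {n : ℕ} (k : Knot n) : ℝ := k.L / RO k.f k.fd univ

/-- The set `I_c` of parameters realizing the minimal double critical distance. -/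
def Knot.Ic {n : ℕ} (k : Knot n) : Set ℝ :=
  {x | ∃ y : ℝ, k.f x ≠ k.f y ∧ ⟪k.f x - k.f y, k.fd x⟫ = 0 ∧
    ⟪k.f x - k.f y, k.fd y⟫ = 0 ∧ ‖k.f x - k.f y‖ = MDC k.f k.fd}

/-- `sup_s κγ(s)` for a knot. -/
def Knot.supCurv {n : ℕ} (k : Knot n) : ℝ := ⨆ s : ℝ, curvAt k.fd univ s

/-- Analytic focal distance `F_k(γ) = (sup_s κγ(s))⁻¹`. -/
def Knot.Fk {n : ℕ} (k : Knot n) : ℝ := (k.supCurv)⁻¹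

/-- Two knots are in the same knot class: after rescaling their domains to `ℝ/ℤ`
(realized by `1`-periodic maps `ℝ → ℝⁿ`), they are joined by a continuous homotopy
through injective loops. -/
def SameKnotClass {n : ℕ} (k₁ k₂ : Knot n) : Prop :=
  ∃ H : ℝ → ℝ → Euc n,
    ContinuousOn (fun z : ℝ × ℝ => H z.1 z.2) (Icc 0 1 ×ˢ univ) ∧
    (∀ t s, H t (s + 1) = H t s) ∧
    (∀ s, H 0 s = k₁.f (k₁.L * s)) ∧
    (∀ s, H 1 s = k₂.f (k₂.L * s)) ∧
    ∀ t ∈ Icc (0 : ℝ) 1, InjOn (H t) (Ico 0 1)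

/-- A knot is relatively extremal: a relative minimum of ropelength within its knot class
with respect to the `C¹` topology (on rescaled parametrizations). -/
def RelativelyExtremal {n : ℕ} (k : Knot n) : Prop :=
  ∃ ε > 0, ∀ η : Knot n, SameKnotClass k η →
    (∀ s : ℝ, ‖η.f (η.L * s) - k.f (k.L * s)‖ +
      ‖η.L • η.fd (η.L * s) - k.L • k.fd (k.L * s)‖ < ε) →
    k.ropelength ≤ η.ropelength

/-- The class `C(p, q; v, w; Λ)`: unit-speed `C^{1,1}` curves `γ : [0, L] → ℝⁿ`
(`L` not fixed) from `p` to `q` with initial/terminal directions `v, w`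
and `Λ`-Lipschitz derivative (curvature at most `Λ`). -/
structure CurveCC (n : ℕ) (p q v w : Euc n) (Λ : ℝ) where
  L : ℝ
  Lnn : 0 ≤ L
  f : ℝ → Euc n
  fd : ℝ → Euc n
  deriv : ∀ s ∈ Icc (0 : ℝ) L, HasDerivWithinAt f (fd s) (Icc 0 L) s
  unit : ∀ s ∈ Icc (0 : ℝ) L, ‖fd s‖ = 1
  lip : LipschitzOnWith Λ.toNNReal fd (Icc 0 L)
  i0 : f 0 = p
  id0 : fd 0 = v
  iL : f L = q
  idL : fd L = w

/-- A `C¹` closed curve of period `L` with nowhere-vanishing derivative. -/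
structure ClosedC1 (n : ℕ) (L : ℝ) where
  f : ℝ → Euc n
  fd : ℝ → Euc n
  per : ∀ s, f (s + L) = f s
  perd : ∀ s, fd (s + L) = fd s
  deriv : ∀ s, HasDerivAt f (fd s) s
  nz : ∀ s, fd s ≠ 0

/-- A simple closed `C^{1,1}` curve of period `L` with nowhere-vanishing derivative. -/
structure ClosedC11 (n : ℕ) (L : ℝ) extends ClosedC1 n L where
  lipd : ∃ C : NNReal, LipschitzWith C fd
  inj : InjOn f (Ico 0 L)

/-- The unit tangent field of `c` is `C`-Lipschitz with respect to the arclength of `c`. -/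
def TangentLip {n : ℕ} {L : ℝ} (c : ClosedC1 n L) (C : ℝ) : Prop :=
  ∀ x y : ℝ, x ≤ y →
    ‖‖c.fd y‖⁻¹ • c.fd y - ‖c.fd x‖⁻¹ • c.fd x‖ ≤ C * ∫ t in x..y, ‖c.fd t‖

/-- Pointwise geometric focal distance `F_g(γ(s))` of the curve `f` with domain `D`. -/
def FgPt {n : ℕ} (f fd : ℝ → Euc n) (D : Set ℝ) (s : ℝ) : ℝ :=
  sInf {r : ℝ | 0 < r ∧ f s ∈ closure (Odisk (f s) (fd s) r ∩ (f '' D))}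

end

section TangentPaths

variable {E : Type*} [NormedAddCommGroup E]

/-- `T` is a tangent indicatrix of curvature at most `Λ`: a `Λ`-Lipschitz field of unit vectors. -/
structure IsTangent (Λ : ℝ) (T : ℝ → E) : Prop where
  lip : ∀ x y, ‖T x - T y‖ ≤ Λ * |x - y|
  unit : ∀ x, ‖T x‖ = 1

theorem continuous_of_norm_sub_le {F : Type*} [NormedAddCommGroup F] {K : ℝ} {V : ℝ → F}
    (hV : ∀ x y, ‖V x - V y‖ ≤ K * |x - y|) : Continuous V :=
  (LipschitzWith.of_dist_le' (K := K) fun x y => by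
    simpa [dist_eq_norm, Real.norm_eq_abs] using hV x y).continuous

theorem IsTangent.continuous {Λ : ℝ} {T : ℝ → E} (hT : IsTangent Λ T) : Continuous T :=
  continuous_of_norm_sub_le hT.lip

theorem IsTangent.intervalIntegrable {Λ : ℝ} {T : ℝ → E} (hT : IsTangent Λ T) (a b : ℝ) :
    IntervalIntegrable T volume a b :=
  hT.continuous.intervalIntegrable a b

theorem IsTangent.nonneg {Λ : ℝ} {T : ℝ → E} (hT : IsTangent Λ T) : 0 ≤ Λ := by
  have := (norm_nonneg _).trans (hT.lip 1 0)
  simpa using this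

theorem IsTangent.reverse {Λ : ℝ} {T : ℝ → E} (hT : IsTangent Λ T) (L : ℝ) :
    IsTangent Λ fun t => -T (L - t) :=
  ⟨fun x y => by
    rw [neg_sub_neg, norm_sub_rev]
    simpa [abs_sub_comm] using hT.lip (L - x) (L - y),
    fun x => by simp [hT.unit]⟩

variable [InnerProductSpace ℝ E]

/-- There is a unit-speed curve of length `ℓ`, curvature at most `Λ`, initial direction `v`,
final direction `w` and total displacement `Δ`. -/
def TangentPath (Λ : ℝ) (v w Δ : E) (ℓ : ℝ) : Prop :=
  0 ≤ ℓ ∧ ∃ T : ℝ → E, IsTangent Λ T ∧ T 0 = v ∧ T ℓ = w ∧ ∫ t in (0 : ℝ)..ℓ, T t = Δ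

theorem IsTangent.tangentPath {Λ : ℝ} {T : ℝ → E} (hT : IsTangent Λ T) {a b : ℝ} (hab : a ≤ b) :
    TangentPath Λ (T a) (T b) (∫ t in a..b, T t) (b - a) := by
  refine ⟨by linarith, fun t => T (t + a), ⟨fun x y => ?_, fun x => hT.unit _⟩, by simp, by simp, ?_⟩
  · simpa using hT.lip (x + a) (y + a)
  · rw [intervalIntegral.integral_comp_add_right]
    simp

theorem IsTangent.norm_integral_sub_le {Λ : ℝ} {T : ℝ → E} (hT : IsTangent Λ T) {a b c : ℝ}
    (hab : a ≤ b) (hc : c ∈ Icc a b) [CompleteSpace E] :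
    ‖(∫ t in a..b, T t) - (b - a) • T c‖ ≤ Λ * (b - a) ^ 2 := by
  have h1 : (∫ t in a..b, T t) - (b - a) • T c = ∫ t in a..b, (T t - T c) := by
    rw [intervalIntegral.integral_sub (hT.intervalIntegrable a b) intervalIntegrable_const]
    simp
  rw [h1]
  have h2 := intervalIntegral.norm_integral_le_of_norm_le_const (a := a) (b := b)
    (f := fun t => T t - T c) (C := Λ * (b - a)) (fun t ht => by
      rw [uIoc_of_le hab] at ht
      refine (hT.lip t c).trans ?_
      have := hT.nonneg
      gcongr
      rw [abs_le]
      constructor <;> linarith [ht.1, ht.2, hc.1, hc.2])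
  rw [abs_of_nonneg (by linarith)] at h2
  linarith

theorem IsTangent.norm_integral_le {Λ : ℝ} {T : ℝ → E} (hT : IsTangent Λ T) {a b : ℝ}
    (hab : a ≤ b) : ‖∫ t in a..b, T t‖ ≤ b - a := by
  have h2 := intervalIntegral.norm_integral_le_of_norm_le_const (a := a) (b := b)
    (f := T) (C := 1) (fun t _ => (hT.unit t).le)
  rwa [abs_of_nonneg (by linarith), one_mul] at h2

theorem TangentPath.norm_le {Λ : ℝ} {v w Δ : E} {ℓ : ℝ} (h : TangentPath Λ v w Δ ℓ) :
    ‖Δ‖ ≤ ℓ := by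
  obtain ⟨h0, T, hT, -, -, rfl⟩ := h
  simpa using hT.norm_integral_le h0

theorem TangentPath.norm_sub_le [CompleteSpace E] {Λ : ℝ} {v w Δ : E} {ℓ : ℝ}
    (h : TangentPath Λ v w Δ ℓ) : ‖Δ - ℓ • w‖ ≤ Λ * ℓ ^ 2 := by
  obtain ⟨h0, T, hT, -, rfl, rfl⟩ := h
  simpa using hT.norm_integral_sub_le h0 (right_mem_Icc.2 h0)

theorem TangentPath.neg {Λ : ℝ} {v w Δ : E} {ℓ : ℝ} (h : TangentPath Λ v w Δ ℓ) :
    TangentPath Λ (-w) (-v) (-Δ) ℓ := by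
  obtain ⟨h0, T, hT, rfl, rfl, rfl⟩ := h
  refine ⟨h0, fun t => -T (ℓ - t), ⟨fun x y => ?_, fun x => by simp [hT.unit]⟩, by simp, by simp, ?_⟩
  · have := hT.lip (ℓ - y) (ℓ - x)
    rwa [neg_sub_neg, show x - y = ℓ - y - (ℓ - x) by ring]
  · simp [intervalIntegral.integral_comp_sub_left]

theorem TangentPath.map {Λ : ℝ} {v w Δ : E} {ℓ : ℝ} [CompleteSpace E]
    (h : TangentPath Λ v w Δ ℓ) (R : E ≃ₗᵢ[ℝ] E) : TangentPath Λ (R v) (R w) (R Δ) ℓ := by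
  obtain ⟨h0, T, hT, rfl, rfl, rfl⟩ := h
  refine ⟨h0, fun t => R (T t), ⟨fun x y => ?_, fun x => by simp [hT.unit]⟩, rfl, rfl, ?_⟩
  · rw [← map_sub, R.norm_map]
    exact hT.lip x y
  · exact R.toContinuousLinearEquiv.toContinuousLinearMap.intervalIntegral_comp_comm
      (hT.intervalIntegrable _ _)

theorem TangentPath.append {Λ : ℝ} {u v w Δ₁ Δ₂ : E} {ℓ₁ ℓ₂ : ℝ}
    (h₁ : TangentPath Λ v u Δ₁ ℓ₁) (h₂ : TangentPath Λ u w Δ₂ ℓ₂) :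
    TangentPath Λ v w (Δ₁ + Δ₂) (ℓ₁ + ℓ₂) := by
  obtain ⟨hℓ₁, T, hT, rfl, rfl, rfl⟩ := h₁
  obtain ⟨hℓ₂, S, hS, hST, rfl, rfl⟩ := h₂
  have hlt : ∀ x y, x ≤ ℓ₁ → ℓ₁ ≤ y → ‖T x - S (y - ℓ₁)‖ ≤ Λ * |x - y| := by
    intro x y hx hy
    calc ‖T x - S (y - ℓ₁)‖ ≤ ‖T x - T ℓ₁‖ + ‖T ℓ₁ - S (y - ℓ₁)‖ := norm_sub_le_norm_sub_add_norm_sub ..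
      _ ≤ Λ * |x - ℓ₁| + Λ * |0 - (y - ℓ₁)| := by
        gcongr
        · exact hT.lip _ _
        · rw [← hST]
          exact hS.lip _ _
      _ = Λ * |x - y| := by
        rw [abs_of_nonpos (by linarith), abs_of_nonpos (by linarith), abs_of_nonpos (by linarith)]
        ring
  have hi1 : ∀ x ≤ ℓ₁, (if x ≤ ℓ₁ then T x else S (x - ℓ₁)) = T x := fun x hx => if_pos hx
  have hi2 : ∀ x, ℓ₁ ≤ x → (if x ≤ ℓ₁ then T x else S (x - ℓ₁)) = S (x - ℓ₁) := by
    intro x hx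
    split_ifs with h
    · obtain rfl := le_antisymm h hx
      simp [hST]
    · rfl
  have htan : IsTangent Λ fun x => if x ≤ ℓ₁ then T x else S (x - ℓ₁) := by
    refine ⟨fun x y => ?_, fun x => ?_⟩
    · rcases le_total x ℓ₁ with hx | hx <;> rcases le_total y ℓ₁ with hy | hy
      · rw [hi1 x hx, hi1 y hy]
        exact hT.lip x y
      · rw [hi1 x hx, hi2 y hy]
        exact hlt x y hx hy
      · rw [hi2 x hx, hi1 y hy, norm_sub_rev, abs_sub_comm]
        exact hlt y x hy hx
      · rw [hi2 x hx, hi2 y hy]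
        simpa using hS.lip (x - ℓ₁) (y - ℓ₁)
    · split_ifs
      · exact hT.unit _
      · exact hS.unit _
  refine ⟨by linarith, _, htan, hi1 0 hℓ₁, ?_, ?_⟩
  · rw [hi2 _ (by linarith)]
    simp
  · rw [← intervalIntegral.integral_add_adjacent_intervals (htan.intervalIntegrable 0 ℓ₁)
      (htan.intervalIntegrable ℓ₁ (ℓ₁ + ℓ₂))]
    congr 1
    · refine intervalIntegral.integral_congr fun x hx => ?_
      rw [uIcc_of_le hℓ₁] at hx
      exact hi1 x hx.2
    · have h1 : EqOn (fun x => if x ≤ ℓ₁ then T x else S (x - ℓ₁)) (fun x => S (x - ℓ₁))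
          (uIcc ℓ₁ (ℓ₁ + ℓ₂)) := by
        intro x hx
        rw [uIcc_of_le (by linarith)] at hx
        exact hi2 x hx.1
      rw [intervalIntegral.integral_congr h1, intervalIntegral.integral_comp_sub_right]
      simp

theorem norm_inv_smul_sub_le {x y : E} {m : ℝ} (hm : 0 < m) (hx : m ≤ ‖x‖) (hy : m ≤ ‖y‖) :
    ‖‖x‖⁻¹ • x - ‖y‖⁻¹ • y‖ ≤ ‖x - y‖ / m := by
  have hx0 : 0 < ‖x‖ := hm.trans_le hx
  have hy0 : 0 < ‖y‖ := hm.trans_le hy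
  have h1 : ‖‖x‖⁻¹ • x - ‖y‖⁻¹ • y‖ ^ 2 = 2 - 2 * (⟪x, y⟫ / (‖x‖ * ‖y‖)) := by
    rw [norm_sub_sq_real, norm_smul, norm_smul, real_inner_smul_left, real_inner_smul_right,
      norm_inv, norm_norm, norm_inv, norm_norm]
    field_simp
    ring
  have h2 := norm_sub_sq_real x y
  rw [le_div_iff₀ hm]
  refine le_of_sq_le_sq ?_ (norm_nonneg _)
  rw [mul_pow, h1]
  set c := ⟪x, y⟫ / (‖x‖ * ‖y‖) with hc
  have h3 : ⟪x, y⟫ = c * (‖x‖ * ‖y‖) := by rw [hc]; field_simp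
  have hc1 : c ≤ 1 := by
    rw [hc, div_le_one (by positivity)]
    exact real_inner_le_norm x y
  have h4 : m ^ 2 ≤ ‖x‖ * ‖y‖ := by rw [sq]; gcongr
  rw [h2, h3]
  nlinarith [sq_nonneg (‖x‖ - ‖y‖)]

/-- Reparametrization by arclength. -/
theorem tangentPath_of_velocity {Λ K m : ℝ} {V : ℝ → E} (hV : ∀ x y, ‖V x - V y‖ ≤ K * |x - y|)
    (hm : 0 < m) (hVm : ∀ x, m ≤ ‖V x‖) (hK : K ≤ Λ * m ^ 2) {a b : ℝ} (hab : a ≤ b) :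
    TangentPath Λ (‖V a‖⁻¹ • V a) (‖V b‖⁻¹ • V b) (∫ t in a..b, V t) (∫ t in a..b, ‖V t‖) := by
  have hVc : Continuous V := continuous_of_norm_sub_le hV
  have hK0 : 0 ≤ K := by simpa using (norm_nonneg _).trans (hV 1 0)
  have hpos : ∀ x, 0 < ‖V x‖ := fun x => hm.trans_le (hVm x)
  set σ : ℝ → ℝ := fun s => ∫ t in a..s, ‖V t‖ with hσ
  have hσd : ∀ s, HasDerivAt σ ‖V s‖ s := fun s =>
    hVc.norm.integral_hasStrictDerivAt a s |>.hasDerivAt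
  have hσc : Continuous σ := continuous_iff_continuousAt.2 fun s => (hσd s).continuousAt
  have hgrow : ∀ x y, x ≤ y → m * (y - x) ≤ σ y - σ x := by
    intro x y hxy
    have h1 : σ y - σ x = ∫ t in x..y, ‖V t‖ :=
      intervalIntegral.integral_interval_sub_left (hVc.norm.intervalIntegrable _ _)
        (hVc.norm.intervalIntegrable _ _)
    have h2 : ∫ _ in x..y, m ≤ ∫ t in x..y, ‖V t‖ :=
      intervalIntegral.integral_mono_on hxy intervalIntegrable_const
        (hVc.norm.intervalIntegrable _ _) fun t _ => hVm t
    rw [h1]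
    simpa [mul_comm] using h2
  have hσa : σ a = 0 := by simp [hσ]
  have htop : Tendsto σ atTop atTop := by
    refine tendsto_atTop_mono' atTop (f₁ := fun x => m * (x - a)) ?_
      ((tendsto_atTop_add_const_right _ (-a) tendsto_id).const_mul_atTop hm)
    filter_upwards [eventually_ge_atTop a] with x hx
    linarith [hgrow a x hx]
  have hbot : Tendsto σ atBot atBot := by
    refine tendsto_atBot_mono' atBot (f₂ := σ) (f₁ := fun x => m * (x - a)) ?_
      ((tendsto_atBot_add_const_right _ (-a) tendsto_id).const_mul_atBot hm)
    filter_upwards [eventually_le_atBot a] with x hx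
    linarith [hgrow x a hx]
  obtain ⟨τ, hτ⟩ := (hσc.surjective htop hbot).hasRightInverse
  have hinj : Function.Injective σ := by
    have : StrictMono σ := fun x y hxy => by
      have := hgrow x y hxy.le
      have : 0 < m * (y - x) := mul_pos hm (by linarith)
      linarith
    exact this.injective
  have hτσ : ∀ s, τ (σ s) = s := fun s => hinj (hτ (σ s))
  have hτlip : ∀ x y, |τ x - τ y| ≤ |x - y| / m := by
    intro x y
    rw [le_div_iff₀ hm]
    nth_rewrite 2 [← hτ x, ← hτ y]
    rcases le_total (τ x) (τ y) with h | h
    · have := hgrow _ _ h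
      rw [abs_of_nonpos (by linarith)]
      refine le_trans ?_ (neg_le_abs _)
      linarith
    · have := hgrow _ _ h
      rw [abs_of_nonneg (by linarith)]
      refine le_trans ?_ (le_abs_self _)
      linarith
  set T : ℝ → E := fun t => ‖V (τ t)‖⁻¹ • V (τ t) with hTdef
  have hT : IsTangent Λ T := by
    refine ⟨fun x y => ?_, fun x => ?_⟩
    · calc ‖T x - T y‖ ≤ ‖V (τ x) - V (τ y)‖ / m := norm_inv_smul_sub_le hm (hVm _) (hVm _)
        _ ≤ (K * (|x - y| / m)) / m := by
          gcongr
          exact (hV _ _).trans (by gcongr; exact hτlip x y)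
        _ = K / m ^ 2 * |x - y| := by field_simp
        _ ≤ Λ * |x - y| := by
          gcongr
          rwa [div_le_iff₀ (by positivity)]
    · rw [hTdef, norm_smul, norm_inv, norm_norm, inv_mul_cancel₀ (hpos _).ne']
  refine ⟨?_, T, hT, ?_, ?_, ?_⟩
  · exact intervalIntegral.integral_nonneg hab fun t _ => norm_nonneg _
  · rw [hTdef, ← hσa]
    simp only [hτσ]
  · change T (σ b) = _
    simp only [hTdef, hτσ]
  · have h := intervalIntegral.integral_deriv_smul_comp (a := a) (b := b) (f := σ)
      (f' := fun s => ‖V s‖) (g := T) (fun x _ => hσd x) hVc.norm.continuousOn hT.continuous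
    rw [hσa] at h
    rw [← h]
    refine intervalIntegral.integral_congr fun x _ => ?_
    simp only [Function.comp, hTdef, hτσ]
    rw [smul_smul, mul_inv_cancel₀ (hpos x).ne', one_smul]

theorem IsTangent.tangentPath_add {Λ Λ' K η : ℝ} {T H : ℝ → E} (hT : IsTangent Λ' T)
    (hH : ∀ x y, ‖H x - H y‖ ≤ K * |x - y|) (hη : η < 1) (hHη : ∀ x, ‖H x‖ ≤ η)
    (hK : Λ' + K ≤ Λ * (1 - η) ^ 2) {a b : ℝ} (hab : a ≤ b) (ha : H a = 0) (hb : H b = 0) :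
    TangentPath Λ (T a) (T b) (∫ t in a..b, (T t + H t)) (∫ t in a..b, ‖T t + H t‖) := by
  have h := tangentPath_of_velocity (V := fun t => T t + H t) (K := Λ' + K) (m := 1 - η) (Λ := Λ)
    (fun x y => by
      calc ‖T x + H x - (T y + H y)‖ = ‖(T x - T y) + (H x - H y)‖ := by congr 1; abel
        _ ≤ ‖T x - T y‖ + ‖H x - H y‖ := norm_add_le _ _
        _ ≤ Λ' * |x - y| + K * |x - y| := add_le_add (hT.lip x y) (hH x y)
        _ = (Λ' + K) * |x - y| := by ring)
    (by linarith)
    (fun x => by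
      have := norm_sub_le_norm_add (T x) (H x)
      rw [hT.unit] at this
      linarith [hHη x]) hK hab
  simpa [ha, hb, hT.unit] using h

end TangentPaths

section Tent

/-- The tent function of slope one supported on `[a, b]`. -/
noncomputable def tent (a b t : ℝ) : ℝ := max 0 ((b - a) / 2 - |t - (a + b) / 2|)

theorem tent_nonneg (a b t : ℝ) : 0 ≤ tent a b t := le_max_left _ _

theorem tent_le {a b : ℝ} (hab : a ≤ b) (t : ℝ) : tent a b t ≤ (b - a) / 2 :=
  max_le (by linarith) (by linarith [abs_nonneg (t - (a + b) / 2)])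

theorem tent_left (a b : ℝ) : tent a b a = 0 :=
  max_eq_left (by linarith [neg_le_abs (a - (a + b) / 2)])

theorem tent_right (a b : ℝ) : tent a b b = 0 :=
  max_eq_left (by linarith [le_abs_self (b - (a + b) / 2)])

theorem tent_pos {a b t : ℝ} (ht : t ∈ Ioo a b) : 0 < tent a b t := by
  refine lt_max_of_lt_right (sub_pos.2 (abs_lt.2 ⟨?_, ?_⟩)) <;> linarith [ht.1, ht.2]

theorem abs_tent_sub_le (a b x y : ℝ) : |tent a b x - tent a b y| ≤ |x - y| := by
  refine (abs_max_sub_max_le_max 0 _ 0 _).trans (max_le (by simp) ?_)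
  rw [sub_sub_sub_cancel_left]
  refine (abs_abs_sub_abs_le_abs_sub _ _).trans ?_
  rw [sub_sub_sub_cancel_right, abs_sub_comm]

theorem continuous_tent (a b : ℝ) : Continuous (tent a b) := by
  unfold tent
  fun_prop

theorem integral_tent_pos {a b : ℝ} (hab : a < b) : 0 < ∫ t in a..b, tent a b t :=
  intervalIntegral.integral_pos hab (continuous_tent a b).continuousOn
    (fun x _ => tent_nonneg a b x) ⟨(a + b) / 2, by constructor <;> linarith,
      tent_pos (by constructor <;> linarith)⟩

end Tent

section Shortest

variable {E : Type*} [NormedAddCommGroup E] [InnerProductSpace ℝ E]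

/-- The tangent field `T` on `[a, b]` belongs to a shortest curve of curvature at most `Λ`. -/
def IsShortest (Λ : ℝ) (T : ℝ → E) (a b : ℝ) : Prop :=
  ∀ ℓ, TangentPath Λ (T a) (T b) (∫ t in a..b, T t) ℓ → b - a ≤ ℓ

theorem IsShortest.mono {Λ : ℝ} {T : ℝ → E} (hT : IsTangent Λ T) {a b a' b' : ℝ}
    (h : IsShortest Λ T a b) (ha : a ≤ a') (_hab : a' ≤ b') (hb : b' ≤ b) :
    IsShortest Λ T a' b' := by
  intro ℓ hℓ
  have h1 := h _ (((hT.tangentPath ha).append hℓ).append (hT.tangentPath hb) |> fun h => by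
    rwa [intervalIntegral.integral_add_adjacent_intervals (hT.intervalIntegrable _ _)
      (hT.intervalIntegrable _ _), intervalIntegral.integral_add_adjacent_intervals
      (hT.intervalIntegrable _ _) (hT.intervalIntegrable _ _)] at h)
  linarith

theorem IsShortest.reverse {Λ : ℝ} {T : ℝ → E} {a b L : ℝ} (h : IsShortest Λ T a b) :
    IsShortest Λ (fun t => -T (L - t)) (L - b) (L - a) := by
  intro ℓ hℓ
  have := h ℓ (by simpa [intervalIntegral.integral_comp_sub_left] using hℓ.neg)
  linarith

variable [CompleteSpace E]

/-- A shortest curve is straight wherever its curvature is bounded away from `Λ`. -/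
theorem IsShortest.eq_left_of_slack {Λ Λ' : ℝ} (hΛ : Λ' < Λ) {T : ℝ → E} (hT : IsTangent Λ' T)
    {a b : ℝ} (hab : a < b) (h : IsShortest Λ T a b) : ∀ t ∈ Icc a b, T t = T a := by
  set φ := tent a b with hφ
  have hφc : Continuous φ := continuous_tent a b
  have hTc := hT.continuous
  have hI : 0 < ∫ t in a..b, φ t := integral_tent_pos hab
  set I := ∫ t in a..b, φ t with hIdef
  set m : E := I⁻¹ • ∫ t in a..b, φ t • T t with hm
  have hmI : ∫ t in a..b, φ t • T t = I • m := by
    rw [hm, smul_smul, mul_inv_cancel₀ hI.ne', one_smul]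
  have hm1 : ‖m‖ ≤ 1 := by
    rw [hm, norm_smul, norm_inv, Real.norm_of_nonneg hI.le, inv_mul_le_iff₀ hI, mul_one]
    refine intervalIntegral.norm_integral_le_of_norm_le hab.le ?_ (hφc.intervalIntegrable _ _)
    refine Eventually.of_forall fun t _ => ?_
    rw [norm_smul, hT.unit, mul_one, Real.norm_of_nonneg (tent_nonneg a b t)]
  obtain ⟨ε, hε0, hε1, hε2⟩ : ∃ ε > 0, ε * (b - a) < 1 ∧
      Λ' + ε * ((b - a) / 2 * Λ' + 2) ≤ Λ * (1 - ε * (b - a)) ^ 2 := by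
    have h1 : ∀ᶠ ε in 𝓝 (0 : ℝ), ε * (b - a) < 1 := by
      have : ContinuousAt (fun ε : ℝ => ε * (b - a)) 0 := by fun_prop
      exact this.eventually_lt continuousAt_const (by simp)
    have h2 : ∀ᶠ ε in 𝓝 (0 : ℝ), Λ' + ε * ((b - a) / 2 * Λ' + 2) < Λ * (1 - ε * (b - a)) ^ 2 := by
      have h3 : ContinuousAt (fun ε : ℝ => Λ' + ε * ((b - a) / 2 * Λ' + 2)) 0 := by fun_prop
      have h4 : ContinuousAt (fun ε : ℝ => Λ * (1 - ε * (b - a)) ^ 2) 0 := by fun_prop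
      exact h3.eventually_lt h4 (by simpa using hΛ)
    have h5 : ∀ᶠ ε in 𝓝[>] (0 : ℝ), 0 < ε := self_mem_nhdsWithin
    obtain ⟨ε, h6, h7, h8⟩ := (h5.and ((h1.and h2).filter_mono nhdsWithin_le_nhds)).exists
    exact ⟨ε, h6, h7, h8.le⟩
  have hmT : ∀ t, ‖m - T t‖ ≤ 2 := fun t => by
    linarith [norm_sub_le m (T t), hT.unit t]
  have hTP := hT.tangentPath_add (Λ := Λ) (K := ε * ((b - a) / 2 * Λ' + 2)) (η := ε * (b - a))
    (H := fun t => (ε * φ t) • (m - T t)) (fun x y => by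
      have e1 : (ε * φ x) • (m - T x) - (ε * φ y) • (m - T y) =
          ε • (φ x • (T y - T x) + (φ x - φ y) • (m - T y)) := by module
      rw [e1, norm_smul, Real.norm_of_nonneg hε0.le, mul_assoc]
      gcongr
      calc _ ≤ ‖φ x • (T y - T x)‖ + ‖(φ x - φ y) • (m - T y)‖ := norm_add_le _ _
        _ ≤ (b - a) / 2 * (Λ' * |x - y|) + |x - y| * 2 := by
          rw [norm_smul, norm_smul, Real.norm_of_nonneg (tent_nonneg a b x), Real.norm_eq_abs]
          exact add_le_add
            (mul_le_mul (tent_le hab.le x) (by rw [norm_sub_rev]; exact hT.lip x y)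
              (norm_nonneg _) (by linarith))
            (mul_le_mul (abs_tent_sub_le a b x y) (hmT y) (norm_nonneg _) (abs_nonneg _))
        _ = _ := by ring)
    hε1 (fun x => by
      rw [norm_smul, Real.norm_of_nonneg (mul_nonneg hε0.le (tent_nonneg a b x)), mul_assoc]
      gcongr
      calc φ x * ‖m - T x‖ ≤ (b - a) / 2 * 2 := by
            exact mul_le_mul (tent_le hab.le x) (hmT x) (norm_nonneg _) (by linarith)
        _ = b - a := by ring)
    hε2 hab.le (by simp [hφ, tent_left]) (by simp [hφ, tent_right])
  have hint : ∫ t in a..b, (T t + (ε * φ t) • (m - T t)) = ∫ t in a..b, T t := by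
    have e1 : ∀ t, T t + (ε * φ t) • (m - T t) = T t + ε • (φ t • m - φ t • T t) := fun t => by module
    simp_rw [e1]
    have hi1 : IntervalIntegrable (fun t => φ t • m) volume a b :=
      (hφc.smul continuous_const).intervalIntegrable _ _
    have hi2 : IntervalIntegrable (fun t => φ t • T t) volume a b :=
      (hφc.smul hTc).intervalIntegrable _ _
    have hi3 : IntervalIntegrable (fun t => ε • (φ t • m - φ t • T t)) volume a b :=
      (hi1.sub hi2).smul ε
    rw [intervalIntegral.integral_add (hT.intervalIntegrable _ _) hi3,
      intervalIntegral.integral_smul, intervalIntegral.integral_sub hi1 hi2, hmI,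
      intervalIntegral.integral_smul_const]
    simp [← hIdef]
  rw [hint] at hTP
  have hlen := h _ hTP
  have hlen2 : ∫ t in a..b, ‖T t + (ε * φ t) • (m - T t)‖ ≤
      ∫ t in a..b, (1 - (ε * (1 - ‖m‖)) * φ t) := by
    refine intervalIntegral.integral_mono_on hab.le
      (Continuous.intervalIntegrable (by fun_prop) _ _)
      (Continuous.intervalIntegrable (by fun_prop) _ _) fun t _ => ?_
    have e1 : T t + (ε * φ t) • (m - T t) = (1 - ε * φ t) • T t + (ε * φ t) • m := by module
    have h0 : 0 ≤ ε * φ t := mul_nonneg hε0.le (tent_nonneg a b t)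
    have h1 : ε * φ t ≤ 1 := by
      have : ε * φ t ≤ ε * (b - a) := by
        gcongr
        linarith [tent_le hab.le t]
      linarith
    rw [e1]
    refine (norm_add_le _ _).trans ?_
    rw [norm_smul, norm_smul, hT.unit, Real.norm_of_nonneg h0, Real.norm_of_nonneg (by linarith)]
    linarith
  have hlen3 : ∫ t in a..b, (1 - (ε * (1 - ‖m‖)) * φ t) = (b - a) - (ε * (1 - ‖m‖)) * I := by
    rw [intervalIntegral.integral_sub intervalIntegrable_const
      ((hφc.const_mul _).intervalIntegrable _ _), intervalIntegral.integral_const_mul]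
    simp [hIdef]
  have hm2 : ‖m‖ = 1 := by
    refine le_antisymm hm1 ?_
    by_contra! hlt
    have : 0 < (ε * (1 - ‖m‖)) * I := mul_pos (mul_pos hε0 (by linarith)) hI
    linarith
  have hzero : ∫ t in a..b, φ t * (1 - ⟪m, T t⟫) = 0 := by
    have e1 : ∀ t, φ t * (1 - ⟪m, T t⟫) = φ t - ⟪m, φ t • T t⟫ := fun t => by
      rw [real_inner_smul_right]; ring
    have e2 : ∫ t in a..b, ⟪m, φ t • T t⟫ = ⟪m, ∫ t in a..b, φ t • T t⟫ :=
      (innerSL ℝ m).intervalIntegral_comp_comm ((hφc.smul hTc).intervalIntegrable _ _)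
    simp_rw [e1]
    rw [intervalIntegral.integral_sub (hφc.intervalIntegrable _ _)
      (Continuous.intervalIntegrable (by fun_prop) _ _), e2, hmI, real_inner_smul_right,
      real_inner_self_eq_norm_sq, hm2]
    simp [hIdef]
  have hin : ∀ t, ⟪m, T t⟫ ≤ 1 := fun t => by
    simpa [hm2, hT.unit] using real_inner_le_norm m (T t)
  have hIoo : ∀ t ∈ Ioo a b, T t = m := by
    intro t ht
    by_contra hne
    have hlt : ⟪m, T t⟫ < 1 :=
      lt_of_le_of_ne (hin t) fun h => hne ((inner_eq_one_iff_of_norm_eq_one hm2 (hT.unit t)).1 h).symm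
    have : 0 < ∫ t in a..b, φ t * (1 - ⟪m, T t⟫) :=
      intervalIntegral.integral_pos hab (by fun_prop)
        (fun x _ => mul_nonneg (tent_nonneg a b x) (by linarith [hin x]))
        ⟨t, Ioo_subset_Icc_self ht, mul_pos (tent_pos ht) (by linarith)⟩
    linarith
  have hIcc : ∀ t ∈ Icc a b, T t = m := by
    rw [← closure_Ioo hab.ne]
    exact fun t ht => closure_minimal hIoo (isClosed_eq hTc continuous_const) ht
  exact fun t ht => (hIcc t ht).trans (hIcc a (left_mem_Icc.2 hab.le)).symm

/-- A straight segment can be deformed to realize any small displacement, its length changing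
by the longitudinal component up to a quadratic error. -/
theorem exists_tangentPath_bend {Λ : ℝ} (hΛ : 0 < Λ) {ℓ : ℝ} (hℓ : 0 < ℓ) {e : E} (he : ‖e‖ = 1) :
    ∃ C > 0, ∃ ε > 0, ∀ Δ : E, ‖Δ‖ ≤ ε → ∃ ℓ' ≤ ℓ + ⟪e, Δ⟫ + C * ‖Δ‖ ^ 2,
      TangentPath Λ e e (ℓ • e + Δ) ℓ' := by
  set φ := tent 0 ℓ with hφ
  have hφc : Continuous φ := continuous_tent 0 ℓ
  have hI : 0 < ∫ t in 0..ℓ, φ t := integral_tent_pos hℓ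
  set I := ∫ t in 0..ℓ, φ t with hIdef
  have hT : IsTangent 0 (fun _ : ℝ => e) := ⟨by simp, fun _ => he⟩
  refine ⟨(ℓ / 2 / I) ^ 2 / 2 * ℓ, by positivity, min (I / ℓ) (Λ * I / 4), by positivity,
    fun Δ hΔ => ?_⟩
  have hΔ1 : ‖Δ‖ / I * (ℓ / 2) ≤ 1 / 2 := by
    have : ‖Δ‖ ≤ I / ℓ := hΔ.trans (min_le_left _ _)
    calc ‖Δ‖ / I * (ℓ / 2) ≤ (I / ℓ) / I * (ℓ / 2) := by gcongr
      _ = 1 / 2 := by field_simp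
  have hΔ2 : ‖Δ‖ / I ≤ Λ / 4 := by
    have : ‖Δ‖ ≤ Λ * I / 4 := hΔ.trans (min_le_right _ _)
    rw [div_le_iff₀ hI]
    linarith
  have hφ0 : ∀ t, 0 ≤ φ t := tent_nonneg 0 ℓ
  have hφ1 : ∀ t, φ t ≤ ℓ / 2 := fun t => by simpa using tent_le hℓ.le t
  have hTP := hT.tangentPath_add (Λ := Λ) (K := ‖Δ‖ / I) (η := 1 / 2)
    (H := fun t => (φ t / I) • Δ) (fun x y => by
      rw [← sub_smul, norm_smul, Real.norm_eq_abs, ← sub_div, abs_div, abs_of_pos hI]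
      calc |φ x - φ y| / I * ‖Δ‖ ≤ |x - y| / I * ‖Δ‖ := by
            refine mul_le_mul_of_nonneg_right ?_ (norm_nonneg _)
            exact div_le_div_of_nonneg_right (abs_tent_sub_le 0 ℓ x y) hI.le
        _ = _ := by ring)
    (by norm_num) (fun x => by
      rw [norm_smul, Real.norm_of_nonneg (div_nonneg (hφ0 x) hI.le)]
      calc φ x / I * ‖Δ‖ = ‖Δ‖ / I * φ x := by ring
        _ ≤ ‖Δ‖ / I * (ℓ / 2) := by gcongr; exact hφ1 x
        _ ≤ 1 / 2 := hΔ1)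
    (by linarith [hΔ2]) hℓ.le (by simp [hφ, tent_left]) (by simp [hφ, tent_right])
  have hint : ∫ t in 0..ℓ, (e + (φ t / I) • Δ) = ℓ • e + Δ := by
    rw [intervalIntegral.integral_add intervalIntegrable_const
      (Continuous.intervalIntegrable (by fun_prop) _ _), intervalIntegral.integral_smul_const,
      intervalIntegral.integral_div, ← hIdef, div_self hI.ne']
    simp
  rw [hint] at hTP
  refine ⟨_, ?_, hTP⟩
  calc ∫ t in 0..ℓ, ‖e + (φ t / I) • Δ‖
      ≤ ∫ t in 0..ℓ, (1 + φ t / I * ⟪e, Δ⟫ + (ℓ / 2 / I) ^ 2 / 2 * ‖Δ‖ ^ 2) := by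
        refine intervalIntegral.integral_mono_on hℓ.le
          (Continuous.intervalIntegrable (by fun_prop) _ _)
          (Continuous.intervalIntegrable (by fun_prop) _ _) fun t _ => ?_
        have h1 : ‖e + (φ t / I) • Δ‖ ^ 2 = 1 + 2 * (φ t / I * ⟪e, Δ⟫) + (φ t / I) ^ 2 * ‖Δ‖ ^ 2 := by
          rw [norm_add_sq_real, he, real_inner_smul_right, norm_smul, mul_pow, Real.norm_eq_abs,
            sq_abs]
          ring
        have h2 : (φ t / I) ^ 2 * ‖Δ‖ ^ 2 ≤ (ℓ / 2 / I) ^ 2 * ‖Δ‖ ^ 2 := by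
          gcongr
          · exact div_nonneg (hφ0 t) hI.le
          · exact hφ1 t
        nlinarith [sq_nonneg (‖e + (φ t / I) • Δ‖ - 1)]
    _ = ℓ + ⟪e, Δ⟫ + (ℓ / 2 / I) ^ 2 / 2 * ℓ * ‖Δ‖ ^ 2 := by
        rw [intervalIntegral.integral_add (Continuous.intervalIntegrable (by fun_prop) _ _)
          intervalIntegrable_const, intervalIntegral.integral_add intervalIntegrable_const
          (Continuous.intervalIntegrable (by fun_prop) _ _), intervalIntegral.integral_mul_const,
          intervalIntegral.integral_div, ← hIdef, div_self hI.ne']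
        simp
        ring

end Shortest

section Subdivision

theorem nonpos_of_subadditive_of_sq_le {G : ℝ → ℝ → ℝ} {x y K h : ℝ} (hxy : x ≤ y) (hh : 0 < h)
    (hsub : ∀ a b, x ≤ a → a ≤ b → b ≤ y → G x b ≤ G x a + G a b)
    (hloc : ∀ a b, x ≤ a → a ≤ b → b ≤ y → b - a < h → G a b ≤ K * (b - a) ^ 2) : G x y ≤ 0 := by
  have key : ∀ N : ℕ, (y - x) / h < N → G x y ≤ K * (y - x) ^ 2 / N := by
    intro N hN
    have hN0 : (0 : ℝ) < N := lt_of_le_of_lt (div_nonneg (by linarith) hh.le) hN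
    set δ := (y - x) / N with hδ
    have hδ0 : 0 ≤ δ := div_nonneg (by linarith) hN0.le
    have hδh : δ < h := by
      rw [hδ, div_lt_iff₀ hN0]
      rwa [div_lt_iff₀ hh, mul_comm] at hN
    have hNδ : N * δ = y - x := by rw [hδ]; field_simp
    have hk : ∀ k : ℕ, k ≤ N → G x (x + k * δ) ≤ k * (K * δ ^ 2) := by
      intro k
      induction k with
      | zero =>
        intro _
        have := hloc x x le_rfl le_rfl hxy (by simpa using hh)
        simpa using this
      | succ k ih =>
        intro hkN
        have h1 := ih (by omega)
        have hkδ : 0 ≤ k * δ := by positivity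
        have hle : x + (k + 1 : ℕ) * δ ≤ y := by
          have : ((k + 1 : ℕ) : ℝ) * δ ≤ N * δ := by gcongr
          linarith
        have hstep : x + (k + 1 : ℕ) * δ - (x + k * δ) = δ := by push_cast; ring
        have h2 := hloc (x + k * δ) (x + (k + 1 : ℕ) * δ) (by linarith) (by linarith) hle
          (by rwa [hstep])
        have h3 := hsub (x + k * δ) (x + (k + 1 : ℕ) * δ) (by linarith) (by linarith) hle
        rw [hstep] at h2
        push_cast at h2 h3 ⊢
        linarith
    have h4 := hk N le_rfl
    rw [hNδ] at h4
    calc G x y = G x (x + (y - x)) := by congr 1; ring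
      _ ≤ N * (K * δ ^ 2) := h4
      _ = K * (y - x) ^ 2 / N := by rw [hδ]; field_simp
  refine ge_of_tendsto (tendsto_const_div_atTop_nhds_zero_nat (K * (y - x) ^ 2)) ?_
  filter_upwards [tendsto_natCast_atTop_atTop.eventually_gt_atTop ((y - x) / h)] with N hN
  exact key N hN

/-- A continuous function whose increments over short intervals are bounded below, to first order
and in absolute value, by `Λ` times their length satisfies this bound over all intervals. -/
theorem mul_sub_le_abs_sub_of_local {g : ℝ → ℝ} (hg : Continuous g) {Λ K h x y : ℝ} (hΛ : 0 < Λ)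
    (hh : 0 < h) (hxy : x ≤ y)
    (hloc : ∀ a b, x ≤ a → a ≤ b → b ≤ y → b - a < h →
      Λ * (b - a) ≤ |g b - g a| + K * (b - a) ^ 2) :
    Λ * (y - x) ≤ |g y - g x| := by
  wlog hK : 0 < K generalizing K
  · refine this (K := 1) (fun a b ha hab hb hlt => ?_) one_pos
    refine (hloc a b ha hab hb hlt).trans ?_
    nlinarith [sq_nonneg (b - a)]
  set h' := min h (Λ / K) with hh'
  have hh'0 : 0 < h' := lt_min hh (by positivity)
  set S : Set (ℝ × ℝ) := {z | x ≤ z.1 ∧ z.2 ≤ y ∧ z.1 < z.2 ∧ z.2 - z.1 < h'} with hS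
  have hconv : Convex ℝ S := by
    have e1 : Convex ℝ {z : ℝ × ℝ | x ≤ z.1} :=
      convex_halfSpace_ge (f := fun z : ℝ × ℝ => z.1) (LinearMap.fst ℝ ℝ ℝ).isLinear x
    have e2 : Convex ℝ {z : ℝ × ℝ | z.2 ≤ y} :=
      convex_halfSpace_le (f := fun z : ℝ × ℝ => z.2) (LinearMap.snd ℝ ℝ ℝ).isLinear y
    have e3 : Convex ℝ {z : ℝ × ℝ | 0 < z.2 - z.1} :=
      convex_halfSpace_gt (f := fun z : ℝ × ℝ => z.2 - z.1)
        (LinearMap.snd ℝ ℝ ℝ - LinearMap.fst ℝ ℝ ℝ).isLinear 0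
    have e4 : Convex ℝ {z : ℝ × ℝ | z.2 - z.1 < h'} :=
      convex_halfSpace_lt (f := fun z : ℝ × ℝ => z.2 - z.1)
        (LinearMap.snd ℝ ℝ ℝ - LinearMap.fst ℝ ℝ ℝ).isLinear h'
    have : S = {z : ℝ × ℝ | x ≤ z.1} ∩ ({z : ℝ × ℝ | z.2 ≤ y} ∩
        ({z : ℝ × ℝ | 0 < z.2 - z.1} ∩ {z : ℝ × ℝ | z.2 - z.1 < h'})) := by
      ext z
      simp [hS]
    rw [this]
    exact e1.inter (e2.inter (e3.inter e4))
  have hne : ∀ z ∈ S, g z.2 - g z.1 ≠ 0 := by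
    rintro ⟨a, b⟩ ⟨h1, h2, h3, h4⟩ h0
    dsimp only at h1 h2 h3 h4 h0
    have := hloc a b h1 h3.le h2 (h4.trans_le (min_le_left _ _))
    rw [h0, abs_zero, zero_add] at this
    have h5 : K * (b - a) < Λ := by
      have := h4.trans_le (min_le_right h (Λ / K))
      rw [lt_div_iff₀ hK] at this
      linarith
    have : K * (b - a) ^ 2 < Λ * (b - a) := by
      have := mul_lt_mul_of_pos_right h5 (sub_pos.2 h3)
      nlinarith
    linarith
  have hsign : (∀ z ∈ S, 0 < g z.2 - g z.1) ∨ ∀ z ∈ S, 0 < -(g z.2 - g z.1) := by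
    by_contra! hcon
    obtain ⟨⟨z, hz, hz0⟩, w, hw, hw0⟩ := hcon
    have := hconv.isPreconnected.intermediate_value hz hw
      (f := fun z => g z.2 - g z.1) (by fun_prop)
    obtain ⟨u, hu, hu0⟩ := this ⟨hz0, by linarith⟩
    exact hne u hu hu0
  have hmain : ∀ f : ℝ → ℝ, (∀ a b, |f b - f a| = |g b - g a|) →
      (∀ z ∈ S, 0 < f z.2 - f z.1) → Λ * (y - x) ≤ |g y - g x| := by
    intro f hfg hf
    have := nonpos_of_subadditive_of_sq_le (G := fun a b => Λ * (b - a) - (f b - f a)) (K := K)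
      hxy hh'0 (fun a b _ _ _ => by linarith) (fun a b h1 h2 h3 h4 => by
        have h5 := hloc a b h1 h2 h3 (h4.trans_le (min_le_left _ _))
        have h6 : |g b - g a| = f b - f a := by
          rw [← hfg]
          rcases h2.eq_or_lt with rfl | h2
          · simp
          · exact abs_of_pos (hf (a, b) ⟨h1, h3, h2, h4⟩)
        linarith)
    rw [← hfg]
    exact (sub_nonpos.1 this).trans (le_abs_self _)
  rcases hsign with hs | hs
  · exact hmain g (fun _ _ => rfl) hs
  · refine hmain (fun t => -g t) (fun a b => ?_) fun z hz => ?_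
    · rw [neg_sub_neg, abs_sub_comm]
    · rw [neg_sub_neg]
      linarith [hs z hz]

end Subdivision

section Angles

open InnerProductGeometry

variable {E : Type*} [NormedAddCommGroup E] [InnerProductSpace ℝ E]

theorem norm_sub_eq_two_mul_sin_angle_div_two {x y : E} (hx : ‖x‖ = 1) (hy : ‖y‖ = 1) :
    ‖x - y‖ = 2 * Real.sin (angle x y / 2) := by
  have h0 := angle_nonneg x y
  have h1 := angle_le_pi x y
  have hs : 0 ≤ Real.sin (angle x y / 2) :=
    Real.sin_nonneg_of_nonneg_of_le_pi (by linarith) (by linarith)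
  rw [← sq_eq_sq₀ (norm_nonneg _) (by positivity), norm_sub_sq_real, hx, hy,
    ← cos_angle_mul_norm_mul_norm x y, hx, hy, mul_pow, Real.sin_sq_eq_half_sub]
  rw [mul_div_cancel₀ _ (two_ne_zero' ℝ)]
  ring

theorem norm_sub_le_angle {x y : E} (hx : ‖x‖ = 1) (hy : ‖y‖ = 1) : ‖x - y‖ ≤ angle x y := by
  rw [norm_sub_eq_two_mul_sin_angle_div_two hx hy]
  have := Real.sin_le (x := angle x y / 2) (by linarith [angle_nonneg x y])
  linarith

theorem angle_le_norm_sub_add_sq {x y : E} (hx : ‖x‖ = 1) (hy : ‖y‖ = 1) :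
    angle x y ≤ ‖x - y‖ + 2 * ‖x - y‖ ^ 2 := by
  have h0 := angle_nonneg x y
  have h1 := angle_le_pi x y
  have hc := norm_sub_eq_two_mul_sin_angle_div_two hx hy
  set θ := angle x y
  have hpi := Real.pi_le_four
  have h2 : θ ≤ 2 * ‖x - y‖ := by
    have := Real.mul_le_sin (x := θ / 2) (by linarith) (by linarith)
    have h3 : 2 / Real.pi * (θ / 2) = θ / Real.pi := by ring
    rw [h3, div_le_iff₀ Real.pi_pos] at this
    have h4 : 0 ≤ Real.sin (θ / 2) := by linarith [norm_nonneg (x - y)]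
    nlinarith
  rcases h0.eq_or_lt with h | h
  · rw [← h]
    positivity
  have h3 := Real.sin_gt_sub_cube (x := θ / 2) (by linarith)
  have h4 : θ ^ 3 ≤ 4 * θ ^ 2 := by nlinarith [sq_nonneg θ]
  have h5 : θ ^ 2 ≤ (2 * ‖x - y‖) ^ 2 := by gcongr
  nlinarith

theorem IsTangent.angle_le {Λ : ℝ} {T : ℝ → E} (hT : IsTangent Λ T) {x y : ℝ} (hxy : x ≤ y) :
    angle (T x) (T y) ≤ Λ * (y - x) := by
  have := nonpos_of_subadditive_of_sq_le (G := fun a b => angle (T a) (T b) - Λ * (b - a))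
    (K := 2 * Λ ^ 2) hxy one_pos (fun a b _ _ _ => by
      linarith [angle_le_angle_add_angle (T x) (T a) (T b)]) (fun a b _ hab _ _ => by
      have h1 := angle_le_norm_sub_add_sq (hT.unit a) (hT.unit b)
      have h2 : ‖T a - T b‖ ≤ Λ * (b - a) := by
        have := hT.lip a b
        rwa [abs_sub_comm, abs_of_nonneg (by linarith)] at this
      have h3 : ‖T a - T b‖ ^ 2 ≤ (Λ * (b - a)) ^ 2 := by gcongr
      linarith)
  linarith

/-- Nearby unit vectors are related by a rotation close to the identity which fixes every vector
orthogonal to both. -/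
theorem exists_rotation {a b : E} (ha : ‖a‖ = 1) (hb : ‖b‖ = 1) (hab : ‖a - b‖ ≤ 1) :
    ∃ R : E ≃ₗᵢ[ℝ] E, R a = b ∧ (∀ e : E, ⟪a, e⟫ = 0 → ⟪b, e⟫ = 0 → R e = e) ∧
      ∀ z, ‖R z - z‖ ≤ 4 * ‖a - b‖ * ‖z‖ := by
  have hm1 : 1 ≤ ‖a + b‖ := by
    have h1 : ‖(2 : ℝ) • a‖ = 2 := by rw [norm_smul, ha]; norm_num
    have h2 : (2 : ℝ) • a = (a + b) + (a - b) := by module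
    have h3 := norm_add_le (a + b) (a - b)
    rw [← h2, h1] at h3
    linarith
  set m : E := ‖a + b‖⁻¹ • (a + b) with hm
  have hmn : ‖m‖ = 1 := by
    rw [hm, norm_smul, norm_inv, norm_norm, inv_mul_cancel₀ (by linarith)]
  have hma : ‖m - a‖ ≤ ‖a - b‖ := by
    have h1 : ‖(2 : ℝ) • a‖ = 2 := by rw [norm_smul, ha]; norm_num
    have h2 := norm_inv_smul_sub_le (x := a + b) (y := (2 : ℝ) • a) one_pos hm1
      (by rw [h1]; norm_num)
    rw [h1, smul_smul, div_one, inv_mul_cancel₀ two_ne_zero, one_smul] at h2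
    calc ‖m - a‖ ≤ ‖a + b - (2 : ℝ) • a‖ := h2
      _ = ‖a - b‖ := by rw [norm_sub_rev a b]; congr 1; module
  have hrefl : ∀ u : E, ‖u‖ = 1 → ∀ z, (ℝ ∙ u)ᗮ.reflection z = z - (2 * ⟪u, z⟫) • u := by
    intro u hu z
    rw [Submodule.reflection_orthogonal_apply, Submodule.reflection_singleton_apply, hu]
    simp only [RCLike.ofReal_real_eq_id, id, one_pow, div_one]
    module
  have hmn2 : ‖a + b‖ ^ 2 = 2 + 2 * ⟪a, b⟫ := by
    rw [norm_add_sq_real, ha, hb]; ring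
  refine ⟨(ℝ ∙ a)ᗮ.reflection.trans (ℝ ∙ m)ᗮ.reflection, ?_, fun e hea heb => ?_, fun z => ?_⟩
  · rw [LinearIsometryEquiv.trans_apply, Submodule.reflection_orthogonalComplement_singleton_eq_neg,
      hrefl m hmn]
    have h1 : ⟪m, -a⟫ = -(‖a + b‖ / 2) := by
      rw [hm, real_inner_smul_left, inner_neg_right, inner_add_left, real_inner_self_eq_norm_sq, ha,
        real_inner_comm]
      field_simp
      linarith
    rw [h1, hm, smul_smul, show 2 * -(‖a + b‖ / 2) * ‖a + b‖⁻¹ = -1 by field_simp]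
    module
  · have h1 : ⟪m, e⟫ = 0 := by
      rw [hm, real_inner_smul_left, inner_add_left, hea, heb]; simp
    rw [LinearIsometryEquiv.trans_apply, hrefl a ha, hea, hrefl m hmn]
    simp [h1]
  · have h1 : ‖(ℝ ∙ m)ᗮ.reflection ((ℝ ∙ a)ᗮ.reflection z) - z‖ =
        ‖(ℝ ∙ a)ᗮ.reflection z - (ℝ ∙ m)ᗮ.reflection z‖ := by
      nth_rewrite 2 [← (ℝ ∙ m)ᗮ.reflection_reflection z]
      rw [← map_sub, LinearIsometryEquiv.norm_map]
    rw [LinearIsometryEquiv.trans_apply, h1, hrefl a ha, hrefl m hmn]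
    have h2 : z - (2 * ⟪a, z⟫) • a - (z - (2 * ⟪m, z⟫) • m) =
        (2 : ℝ) • (⟪m - a, z⟫ • m + ⟪a, z⟫ • (m - a)) := by
      rw [inner_sub_left]
      module
    rw [h2, norm_smul]
    have h3 : ‖⟪m - a, z⟫ • m‖ ≤ ‖a - b‖ * ‖z‖ := by
      rw [norm_smul, hmn, mul_one]
      exact (norm_inner_le_norm _ _).trans (by gcongr)
    have h4 : ‖⟪a, z⟫ • (m - a)‖ ≤ ‖z‖ * ‖a - b‖ := by
      rw [norm_smul]
      gcongr
      simpa [ha] using norm_inner_le_norm (𝕜 := ℝ) a z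
    have h5 := norm_add_le (⟪m - a, z⟫ • m) (⟪a, z⟫ • (m - a))
    rw [Real.norm_ofNat]
    linarith

end Angles

section Meridian

open InnerProductGeometry

variable {E : Type*} [NormedAddCommGroup E] [InnerProductSpace ℝ E]

/-- The point at angle `α` on the unit circle spanned by `e` and `u`. -/
noncomputable def circlePoint (e u : E) (α : ℝ) : E := Real.cos α • e + Real.sin α • u

theorem inner_circlePoint {e u u' : E} (he : ‖e‖ = 1) (hu : ⟪e, u⟫ = 0) (hu' : ⟪e, u'⟫ = 0)
    (α β : ℝ) : ⟪circlePoint e u α, circlePoint e u' β⟫ =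
      Real.cos α * Real.cos β + Real.sin α * Real.sin β * ⟪u, u'⟫ := by
  have hee : ⟪e, e⟫ = 1 := by simp [he]
  rw [real_inner_comm] at hu
  simp only [circlePoint, inner_add_left, inner_add_right, real_inner_smul_left,
    real_inner_smul_right, hu, hu', hee]
  ring

theorem isTangent_circlePoint {e u : E} (he : ‖e‖ = 1) (hu : ‖u‖ = 1) (heu : ⟪e, u⟫ = 0) :
    IsTangent 1 (circlePoint e u) := by
  have huu : ⟪u, u⟫ = 1 := by simp [hu]
  have hunit : ∀ x, ‖circlePoint e u x‖ = 1 := fun x => by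
    rw [← sq_eq_sq₀ (norm_nonneg _) zero_le_one, ← real_inner_self_eq_norm_sq,
      inner_circlePoint he heu heu, huu]
    linarith [Real.sin_sq_add_cos_sq x]
  refine ⟨fun x y => ?_, hunit⟩
  rw [one_mul, ← sq_le_sq₀ (norm_nonneg _) (abs_nonneg _), sq_abs, norm_sub_sq_real, hunit, hunit,
    inner_circlePoint he heu heu, huu, mul_one, ← Real.cos_sub]
  linarith [Real.one_sub_sq_div_two_le_cos (x := x - y)]

theorem exists_tangentPath_meridian {Λ : ℝ} (hΛ : 0 < Λ) {e u : E} (he : ‖e‖ = 1) (hu : ‖u‖ = 1)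
    (heu : ⟪e, u⟫ = 0) (α β : ℝ) :
    ∃ Δ, TangentPath Λ (circlePoint e u α) (circlePoint e u β) Δ (|β - α| / Λ) := by
  have hT := isTangent_circlePoint he hu heu
  set σ : ℝ := (SignType.sign (β - α) : ℝ) with hσ
  have hσ1 : |σ| ≤ 1 := by
    rcases lt_trichotomy (β - α) 0 with h | h | h <;> simp [hσ, h]
  have hσ2 : σ * Λ * (|β - α| / Λ) = β - α := by
    rw [mul_assoc, mul_div_cancel₀ _ hΛ.ne', hσ, sign_mul_abs]
  refine ⟨_, by positivity, fun t => circlePoint e u (α + σ * Λ * t),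
    ⟨fun x y => ?_, fun x => hT.unit _⟩, by simp, by simp [hσ2], rfl⟩
  refine (hT.lip _ _).trans ?_
  rw [one_mul, add_sub_add_left_eq_sub, ← mul_sub, abs_mul, abs_mul, abs_of_pos hΛ, mul_assoc]
  exact mul_le_of_le_one_left (by positivity) hσ1

/-- The unit vector orthogonal to `e` pointing from `e` to `x` along their great circle. -/
noncomputable def longitude (e x : E) : E := ‖x - ⟪e, x⟫ • e‖⁻¹ • (x - ⟪e, x⟫ • e)

theorem norm_sub_inner_smul {e x : E} (he : ‖e‖ = 1) (hx : ‖x‖ = 1) :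
    ‖x - ⟪e, x⟫ • e‖ = Real.sin (angle e x) := by
  have h1 := cos_angle_mul_norm_mul_norm e x
  rw [he, hx, mul_one, mul_one] at h1
  rw [← sq_eq_sq₀ (norm_nonneg _) (sin_angle_nonneg e x), norm_sub_sq_real, hx, norm_smul, he,
    real_inner_smul_right, real_inner_comm e x, ← h1, Real.sin_sq, Real.norm_eq_abs, mul_one,
    sq_abs]
  ring

theorem inner_longitude {e : E} (he : ‖e‖ = 1) (x : E) : ⟪e, longitude e x⟫ = 0 := by
  simp [longitude, real_inner_smul_right, inner_sub_right, he]

theorem norm_longitude {e x : E} (he : ‖e‖ = 1) (hx : ‖x‖ = 1) (h : 0 < Real.sin (angle e x)) :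
    ‖longitude e x‖ = 1 := by
  rw [longitude, norm_smul, norm_inv, norm_norm, norm_sub_inner_smul he hx, inv_mul_cancel₀ h.ne']

theorem circlePoint_longitude {e x : E} (he : ‖e‖ = 1) (hx : ‖x‖ = 1)
    (h : 0 < Real.sin (angle e x)) : circlePoint e (longitude e x) (angle e x) = x := by
  have h1 := cos_angle_mul_norm_mul_norm e x
  rw [he, hx, mul_one, mul_one] at h1
  rw [circlePoint, longitude, norm_sub_inner_smul he hx, smul_inv_smul₀ h.ne', h1]
  module

theorem norm_longitude_sub_le {e x y : E} {m : ℝ} (hm : 0 < m) (he : ‖e‖ = 1) (hx : ‖x‖ = 1)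
    (hy : ‖y‖ = 1) (hmx : m ≤ Real.sin (angle e x)) (hmy : m ≤ Real.sin (angle e y)) :
    ‖longitude e x - longitude e y‖ ≤ 2 * ‖x - y‖ / m := by
  refine (norm_inv_smul_sub_le hm (by rwa [norm_sub_inner_smul he hx])
    (by rwa [norm_sub_inner_smul he hy])).trans ?_
  gcongr
  have h1 : x - ⟪e, x⟫ • e - (y - ⟪e, y⟫ • e) = (x - y) - ⟪e, x - y⟫ • e := by
    rw [inner_sub_right]; module
  have h2 := norm_sub_le (x - y) (⟪e, x - y⟫ • e)
  have h3 := abs_real_inner_le_norm e (x - y)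
  rw [norm_smul, he, Real.norm_eq_abs] at h2
  rw [he] at h3
  rw [h1]
  linarith

theorem abs_angle_sub_le (e x y : E) : |angle e y - angle e x| ≤ angle x y := by
  rw [abs_le]
  have h1 := angle_le_angle_add_angle e x y
  have h2 := angle_le_angle_add_angle e y x
  rw [angle_comm y x] at h2
  constructor <;> linarith

theorem IsTangent.continuous_angle {Λ : ℝ} {T : ℝ → E} (hT : IsTangent Λ T) {e : E}
    (he : ‖e‖ = 1) : Continuous fun s => angle e (T s) := by
  refine continuous_iff_continuousAt.2 fun s => ?_
  have hne : ∀ x : E, ‖x‖ = 1 → x ≠ 0 := fun x hx h => by simp [h] at hx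
  exact (continuousAt_angle (x := (e, T s)) (hne _ he) (hne _ (hT.unit s))).comp
    (f := fun s => (e, T s)) (continuous_const.prodMk hT.continuous).continuousAt

variable [CompleteSpace E]

theorem IsShortest.exists_mul_sub_le {Λ : ℝ} (hΛ : 0 < Λ) {T : ℝ → E} (hT : IsTangent Λ T)
    {c d x y z : ℝ} (h : IsShortest Λ T c z) (hcd : c < d) {e : E}
    (he : ∀ t ∈ Icc c d, T t = e) (hdx : d ≤ x) (hxy : x ≤ y) (hyz : y ≤ z)
    (hθ : ∀ s ∈ Icc x y, angle e (T s) ∈ Ioo 0 Real.pi) :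
    ∃ K, ∃ δ > 0, ∀ a b, x ≤ a → a ≤ b → b ≤ y → b - a < δ →
      Λ * (b - a) ≤ |angle e (T b) - angle e (T a)| + K * (b - a) ^ 2 := by
  have he1 : ‖e‖ = 1 := by rw [← he c ⟨le_rfl, hcd.le⟩]; exact hT.unit c
  have hθc := hT.continuous_angle he1
  obtain ⟨m, hm, hms, hmc⟩ : ∃ m > 0, (∀ s ∈ Icc x y, m ≤ Real.sin (angle e (T s))) ∧
      ∀ s ∈ Icc x y, m ≤ 1 - Real.cos (angle e (T s)) := by
    obtain ⟨s₁, hs₁, hmin₁⟩ := isCompact_Icc.exists_isMinOn (nonempty_Icc.2 hxy)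
      (Real.continuous_sin.comp hθc).continuousOn
    obtain ⟨s₂, hs₂, hmin₂⟩ := isCompact_Icc.exists_isMinOn (nonempty_Icc.2 hxy)
      (continuous_const.sub (Real.continuous_cos.comp hθc) :
        Continuous fun s => 1 - Real.cos (angle e (T s))).continuousOn
    refine ⟨min (Real.sin (angle e (T s₁))) (1 - Real.cos (angle e (T s₂))), lt_min
      (Real.sin_pos_of_pos_of_lt_pi (hθ _ hs₁).1 (hθ _ hs₁).2) (sub_pos.2 ?_),
      fun s hs => (min_le_left _ _).trans (hmin₁ hs),
      fun s hs => (min_le_right _ _).trans (hmin₂ hs)⟩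
    have := Real.cos_lt_cos_of_nonneg_of_le_pi le_rfl (hθ _ hs₂).2.le (hθ _ hs₂).1
    rwa [Real.cos_zero] at this
  obtain ⟨C, hC, ε, hε, hbend⟩ := exists_tangentPath_bend hΛ (sub_pos.2 hcd) he1
  have hyd : 0 ≤ y - d := by linarith
  set C₂ := 8 * Λ * (y - d) / m + 2 with hC₂
  have hC₂0 : 0 < C₂ := by positivity
  refine ⟨Λ * ((2 * Λ + C * C₂ ^ 2) / m), min (m / (2 * Λ)) (ε / C₂), by positivity, ?_⟩
  intro a b hxa hab hby hlt
  have hlt₁ := hlt.trans_le (min_le_left _ _)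
  have hlt₂ := hlt.trans_le (min_le_right _ _)
  rw [lt_div_iff₀ (by positivity)] at hlt₁ hlt₂
  have ha : a ∈ Icc x y := ⟨hxa, hab.trans hby⟩
  have hb : b ∈ Icc x y := ⟨hxa.trans hab, hby⟩
  have hda : d ≤ a := hdx.trans hxa
  set k := b - a with hk
  have hk0 : 0 ≤ k := sub_nonneg.2 hab
  have hsa := hm.trans_le (hms a ha)
  have hsb := hm.trans_le (hms b hb)
  have hTab : ‖T a - T b‖ ≤ Λ * k := by
    have := hT.lip a b
    rwa [abs_sub_comm, ← hk, abs_of_nonneg hk0] at this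
  have hlon : ‖longitude e (T a) - longitude e (T b)‖ ≤ 2 * (Λ * k) / m :=
    (norm_longitude_sub_le hm he1 (hT.unit a) (hT.unit b) (hms a ha) (hms b hb)).trans (by gcongr)
  obtain ⟨R, hRa, hRe, hRz⟩ := exists_rotation (norm_longitude he1 (hT.unit a) hsa)
    (norm_longitude he1 (hT.unit b) hsb) (hlon.trans (by rw [div_le_one hm]; linarith))
  replace hRe : R e = e := hRe e (by rw [real_inner_comm]; exact inner_longitude he1 _)
    (by rw [real_inner_comm]; exact inner_longitude he1 _)
  obtain ⟨Δ, hΔ⟩ := exists_tangentPath_meridian hΛ he1 (norm_longitude he1 (hT.unit b) hsb)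
    (inner_longitude he1 _) (angle e (T a)) (angle e (T b))
  rw [circlePoint_longitude he1 (hT.unit b) hsb] at hΔ
  have hRT : R (T a) = circlePoint e (longitude e (T b)) (angle e (T a)) := by
    conv_lhs => rw [← circlePoint_longitude he1 (hT.unit a) hsa]
    simp only [circlePoint, map_add, map_smul, hRe, hRa]
  rw [← hRT] at hΔ
  set ℓ := |angle e (T b) - angle e (T a)| / Λ with hℓ
  have hℓ0 : 0 ≤ ℓ := hΔ.1
  have hℓk : ℓ ≤ k := by
    rw [hℓ, div_le_iff₀ hΛ, mul_comm]
    exact (abs_angle_sub_le e (T a) (T b)).trans (hT.angle_le hab)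
  set D₁ := ∫ t in d..a, T t with hD₁
  set D₂ := ∫ t in a..b, T t with hD₂
  have hD₁n : ‖D₁‖ ≤ y - d := (hT.norm_integral_le hda).trans (by linarith [ha.2])
  have hD₂n : ‖D₂‖ ≤ k := hT.norm_integral_le hab
  have hDn : ‖D₁ - R D₁ + D₂ - Δ‖ ≤ C₂ * k := by
    have h1 : ‖D₁ - R D₁‖ ≤ 4 * (2 * (Λ * k) / m) * (y - d) := by
      rw [norm_sub_rev]
      exact (hRz D₁).trans (by gcongr)
    calc ‖D₁ - R D₁ + D₂ - Δ‖ ≤ ‖D₁ - R D₁‖ + ‖D₂‖ + ‖Δ‖ :=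
          (norm_sub_le _ _).trans (by gcongr; exact norm_add_le _ _)
      _ ≤ 4 * (2 * (Λ * k) / m) * (y - d) + k + k := by
          gcongr; exact hΔ.norm_le.trans hℓk
      _ = C₂ * k := by rw [hC₂]; ring
  obtain ⟨ℓ', hℓ', hpath⟩ := hbend (D₁ - R D₁ + D₂ - Δ)
    (hDn.trans (by linarith))
  have hmid := (hT.tangentPath hda).map R
  rw [he d ⟨hcd.le, le_rfl⟩, hRe] at hmid
  have htot := (hpath.append hmid).append hΔ
  have hcb := h.mono hT le_rfl (by linarith : c ≤ b) (hby.trans hyz)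
  have hint : ∫ t in c..b, T t = (d - c) • e + D₁ + D₂ := by
    rw [← intervalIntegral.integral_add_adjacent_intervals (hT.intervalIntegrable c a)
        (hT.intervalIntegrable a b),
      ← intervalIntegral.integral_add_adjacent_intervals (hT.intervalIntegrable c d)
        (hT.intervalIntegrable d a)]
    congr 2
    rw [intervalIntegral.integral_congr (g := fun _ => e)
      (fun t ht => he t (by rwa [uIcc_of_le hcd.le] at ht))]
    simp
  have hlen := hcb _ (by
    rw [he c ⟨le_rfl, hcd.le⟩, hint]
    convert htot using 1
    rw [← hD₁]
    module)
  have hin : ⟪e, D₁ - R D₁ + D₂ - Δ⟫ ≤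
      (k - ℓ) * Real.cos (angle e (T b)) + 2 * Λ * k ^ 2 := by
    have h1 : ⟪e, R D₁⟫ = ⟪e, D₁⟫ := by
      conv_lhs => rw [← hRe]
      exact R.inner_map_map _ _
    have h2 := cos_angle_mul_norm_mul_norm e (T b)
    rw [he1, hT.unit, mul_one, mul_one] at h2
    have h3 : ‖D₂ - k • T b‖ ≤ Λ * k ^ 2 := hT.norm_integral_sub_le hab (right_mem_Icc.2 hab)
    have h4 : ‖Δ - ℓ • T b‖ ≤ Λ * k ^ 2 := hΔ.norm_sub_le.trans (by gcongr)
    have h5 : ⟪e, (D₂ - k • T b) - (Δ - ℓ • T b)⟫ ≤ 2 * Λ * k ^ 2 := by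
      refine (real_inner_le_norm _ _).trans ?_
      rw [he1, one_mul]
      exact (norm_sub_le _ _).trans (by linarith)
    simp only [inner_sub_right, inner_add_right, real_inner_smul_right, ← h2] at h5 ⊢
    rw [h1]
    linarith
  have hsq : C * ‖D₁ - R D₁ + D₂ - Δ‖ ^ 2 ≤ C * (C₂ * k) ^ 2 := by gcongr
  have hmain : (k - ℓ) * m ≤ (2 * Λ + C * C₂ ^ 2) * k ^ 2 := by
    have h1 : (k - ℓ) * m ≤ (k - ℓ) * (1 - Real.cos (angle e (T b))) := by
      have := hmc b hb
      have := sub_nonneg.2 hℓk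
      gcongr
    have h2 : b - c = k + (a - d) + (d - c) := by rw [hk]; ring
    linarith
  have hfin : k - ℓ ≤ (2 * Λ + C * C₂ ^ 2) / m * k ^ 2 := by
    rw [div_mul_eq_mul_div, le_div_iff₀ hm]
    exact hmain
  have hℓΛ : Λ * ℓ = |angle e (T b) - angle e (T a)| := mul_div_cancel₀ _ hΛ.ne'
  have := mul_le_mul_of_nonneg_left hfin hΛ.le
  linarith

theorem IsShortest.mul_sub_le_abs_angle_sub {Λ : ℝ} (hΛ : 0 < Λ) {T : ℝ → E} (hT : IsTangent Λ T)
    {c d x y z : ℝ} (h : IsShortest Λ T c z) (hcd : c < d) {e : E}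
    (he : ∀ t ∈ Icc c d, T t = e) (hdx : d ≤ x) (hxy : x ≤ y) (hyz : y ≤ z)
    (hθ : ∀ s ∈ Icc x y, angle e (T s) ∈ Ioo 0 Real.pi) :
    Λ * (y - x) ≤ |angle e (T y) - angle e (T x)| := by
  have he1 : ‖e‖ = 1 := by rw [← he c ⟨le_rfl, hcd.le⟩]; exact hT.unit c
  obtain ⟨K, δ, hδ, hloc⟩ := h.exists_mul_sub_le hΛ hT hcd he hdx hxy hyz hθ
  exact mul_sub_le_abs_sub_of_local (g := fun s => angle e (T s)) (hT.continuous_angle he1) hΛ hδ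
    hxy hloc

end Meridian

section Arcs

open InnerProductGeometry

variable {E : Type*} [NormedAddCommGroup E] [InnerProductSpace ℝ E]

theorem exists_Ioo_ne_of_eq_of_eq {g : ℝ → ℝ} (hg : Continuous g) {w x y z : ℝ} (hx : x ∈ Icc w z)
    (hw : g w = y) (hz : g z = y) (hxy : g x ≠ y) :
    ∃ α β, w ≤ α ∧ α < β ∧ β ≤ z ∧ g α = y ∧ g β = y ∧ ∀ s ∈ Ioo α β, g s ≠ y := by
  have hcl : IsClosed {s | g s = y} := isClosed_eq hg continuous_const
  obtain ⟨α, ⟨hα, hgα⟩, hαm⟩ := (isCompact_Icc.inter_right hcl : IsCompact (Icc w x ∩ _)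
    ).exists_isGreatest ⟨w, ⟨le_rfl, hx.1⟩, hw⟩
  obtain ⟨β, ⟨hβ, hgβ⟩, hβm⟩ := (isCompact_Icc.inter_right hcl : IsCompact (Icc x z ∩ _)
    ).exists_isLeast ⟨z, ⟨hx.2, le_rfl⟩, hz⟩
  have hαx : α < x := hα.2.lt_of_ne fun h => hxy (h ▸ hgα)
  have hxβ : x < β := hβ.1.lt_of_ne fun h => hxy (h ▸ hgβ)
  refine ⟨α, β, hα.1, hαx.trans hxβ, hβ.2, hgα, hgβ, fun s hs h => ?_⟩
  rcases le_total s x with hsx | hsx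
  · exact hs.1.not_ge (hαm ⟨⟨hα.1.trans hs.1.le, hsx⟩, h⟩)
  · exact hs.2.not_ge (hβm ⟨⟨hsx, hs.2.le.trans hβ.2⟩, h⟩)

variable [CompleteSpace E]

/-- After a maximal straight piece, a shortest curve turns along a great circle at full speed. -/
theorem IsShortest.exists_eq_circlePoint {Λ : ℝ} (hΛ : 0 < Λ) {T : ℝ → E} (hT : IsTangent Λ T)
    {c d z : ℝ} (h : IsShortest Λ T c z) (hcd : c < d) {e : E} (he : ∀ t ∈ Icc c d, T t = e)
    (hdz : d < z) (hne : ∀ t > d, ∃ s ∈ Ioo d t, T s ≠ e) :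
    ∃ u, ‖u‖ = 1 ∧ ⟪e, u⟫ = 0 ∧
      ∀ s ∈ Icc d (min z (d + Real.pi / Λ)), T s = circlePoint e u (Λ * (s - d)) := by
  have hTd : T d = e := he d ⟨hcd.le, le_rfl⟩
  have he1 : ‖e‖ = 1 := hTd ▸ hT.unit d
  have he0 : e ≠ 0 := fun h0 => by simp [h0] at he1
  have hθc := hT.continuous_angle he1
  set θ : ℝ → ℝ := fun s => angle e (T s) with hθ
  set E₁ := min z (d + Real.pi / Λ) with hE₁
  have hdE : d < E₁ := lt_min hdz (lt_add_of_pos_right d (by positivity))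
  have hθd : θ d = 0 := by simp only [hθ, hTd]; exact angle_self he0
  have hθ0 : ∀ s, 0 ≤ θ s := fun s => angle_nonneg _ _
  have hθle : ∀ s, d ≤ s → θ s ≤ Λ * (s - d) := fun s hs => by
    have := hT.angle_le hs
    rwa [hTd] at this
  have hE₁π : Λ * (E₁ - d) ≤ Real.pi := by
    rw [mul_comm, ← le_div_iff₀ hΛ]
    linarith [min_le_right z (d + Real.pi / Λ)]
  have hlt : ∀ s, s < E₁ → Λ * (s - d) < Real.pi := fun s hs =>
    lt_of_lt_of_le (by gcongr) hE₁π
  have hgrow : ∀ α β, d ≤ α → α < β → β ≤ E₁ → (∀ s ∈ Ioo α β, θ s ≠ 0) →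
      Λ * (β - α) ≤ |θ β - θ α| := by
    intro α β hα hαβ hβ hpos
    have hlim : Tendsto (fun ε : ℝ => |θ (β - ε) - θ (α + ε)| - Λ * (β - ε - (α + ε))) (𝓝[>] 0)
        (𝓝 (|θ (β - 0) - θ (α + 0)| - Λ * (β - 0 - (α + 0)))) :=
      (Continuous.tendsto (by fun_prop) 0).mono_left nhdsWithin_le_nhds
    have := ge_of_tendsto hlim (b := 0) (by
      filter_upwards [Ioo_mem_nhdsGT (half_pos (sub_pos.2 hαβ))] with ε hε
      have := hε.1
      have := hε.2
      refine sub_nonneg.2 (h.mul_sub_le_abs_angle_sub hΛ hT hcd he (by linarith) (by linarith)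
        (by linarith [min_le_left z (d + Real.pi / Λ)]) fun s hs => ⟨(hθ0 s).lt_of_ne' (hpos s
          ⟨by linarith [hs.1], by linarith [hs.2]⟩), (hθle s (by linarith [hs.1])).trans_lt
          (hlt s (by linarith [hs.2]))⟩))
    simp only [sub_zero, add_zero] at this
    linarith
  have hθpos : ∀ s ∈ Ioo d E₁, θ s ≠ 0 := by
    intro t ht ht0
    obtain ⟨s, hs, hsne⟩ := hne t ht.1
    have hs0 : θ s ≠ 0 := fun h0 => by
      obtain ⟨-, r, hr, hre⟩ := angle_eq_zero_iff.1 h0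
      have := congrArg norm hre
      rw [hT.unit, norm_smul, he1, mul_one, Real.norm_eq_abs, abs_of_pos hr] at this
      rw [← this, one_smul] at hre
      exact hsne hre
    obtain ⟨α, β, hα, hαβ, hβ, hgα, hgβ, hgne⟩ :=
      exists_Ioo_ne_of_eq_of_eq hθc ⟨hs.1.le, hs.2.le⟩ hθd ht0 hs0
    have := hgrow α β hα hαβ (hβ.trans ht.2.le) hgne
    rw [hgα, hgβ, sub_self, abs_zero] at this
    exact this.not_gt (mul_pos hΛ (sub_pos.2 hαβ))
  have hθeq : ∀ s ∈ Ioo d E₁, θ s = Λ * (s - d) := by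
    intro s hs
    refine (hθle s hs.1.le).antisymm ?_
    have := hgrow d s le_rfl hs.1 hs.2.le fun r hr => hθpos r ⟨hr.1, hr.2.trans hs.2⟩
    rwa [hθd, sub_zero, abs_of_nonneg (hθ0 s)] at this
  have hsin : ∀ s ∈ Ioo d E₁, 0 < Real.sin (angle e (T s)) := fun s hs =>
    Real.sin_pos_of_pos_of_lt_pi ((hθ0 s).lt_of_ne' (hθpos s hs))
      ((hθle s hs.1.le).trans_lt (hlt s hs.2))
  have hlon : ∀ x ∈ Ioo d E₁, ∀ y ∈ Ioo d E₁, x ≤ y → longitude e (T x) = longitude e (T y) := by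
    intro x hx y hy hxy
    rw [← inner_eq_one_iff_of_norm_eq_one (𝕜 := ℝ) (norm_longitude he1 (hT.unit x) (hsin x hx))
      (norm_longitude he1 (hT.unit y) (hsin y hy))]
    refine le_antisymm ((real_inner_le_norm _ _).trans ?_) ?_
    · rw [norm_longitude he1 (hT.unit x) (hsin x hx), norm_longitude he1 (hT.unit y) (hsin y hy),
        one_mul]
    have h1 : angle (T x) (T y) ≤ θ y - θ x := by
      rw [hθeq x hx, hθeq y hy]
      exact (hT.angle_le hxy).trans (by linarith)
    have h2 := Real.cos_le_cos_of_nonneg_of_le_pi (angle_nonneg _ _)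
      (by linarith [hθ0 x, hθle y hy.1.le, hlt y hy.2]) h1
    have h3 := cos_angle_mul_norm_mul_norm (T x) (T y)
    rw [hT.unit, hT.unit, mul_one, mul_one] at h3
    rw [h3, ← circlePoint_longitude he1 (hT.unit x) (hsin x hx),
      ← circlePoint_longitude he1 (hT.unit y) (hsin y hy), inner_circlePoint he1
        (inner_longitude he1 _) (inner_longitude he1 _), Real.cos_sub] at h2
    have h4 := mul_pos (hsin x hx) (hsin y hy)
    have h5 : Real.sin (θ x) * Real.sin (θ y) * 1 ≤
        Real.sin (θ x) * Real.sin (θ y) * ⟪longitude e (T x), longitude e (T y)⟫ := by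
      simp only [hθ] at h2 ⊢
      linarith
    exact le_of_mul_le_mul_left h5 h4
  have hmid : (d + E₁) / 2 ∈ Ioo d E₁ := ⟨by linarith, by linarith⟩
  refine ⟨longitude e (T ((d + E₁) / 2)), norm_longitude he1 (hT.unit _) (hsin _ hmid),
    inner_longitude he1 _, ?_⟩
  have hEq : EqOn T (fun s => circlePoint e (longitude e (T ((d + E₁) / 2))) (Λ * (s - d)))
      (Ioo d E₁) := by
    intro s hs
    have : longitude e (T ((d + E₁) / 2)) = longitude e (T s) := by
      rcases le_total s ((d + E₁) / 2) with hle | hle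
      · exact (hlon _ hs _ hmid hle).symm
      · exact hlon _ hmid _ hs hle
    simp only [this, ← hθeq s hs]
    exact (circlePoint_longitude he1 (hT.unit s) (hsin s hs)).symm
  have := hEq.closure hT.continuous (by unfold circlePoint; fun_prop)
  rwa [closure_Ioo hdE.ne] at this

theorem integral_circlePoint {Λ : ℝ} (hΛ : Λ ≠ 0) (e u : E) (a b : ℝ) :
    ∫ t in a..b, circlePoint e u (Λ * (t - a)) =
      (Λ⁻¹ * Real.sin (Λ * (b - a))) • e + (Λ⁻¹ * (1 - Real.cos (Λ * (b - a)))) • u := by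
  have hd : ∀ t ∈ uIcc a b, HasDerivAt (fun t => (Λ⁻¹ * Real.sin (Λ * (t - a))) • e +
      (Λ⁻¹ * (1 - Real.cos (Λ * (t - a)))) • u) (circlePoint e u (Λ * (t - a))) t := by
    intro t _
    have h0 : HasDerivAt (fun t => Λ * (t - a)) Λ t := by
      simpa using ((hasDerivAt_id t).sub_const a).const_mul Λ
    have h1 := (h0.sin.const_mul Λ⁻¹).smul_const e
    have h2 := ((h0.cos.const_sub 1).const_mul Λ⁻¹).smul_const u
    refine (h1.add h2).congr_deriv ?_
    simp only [circlePoint]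
    congr 2 <;> field_simp
  rw [intervalIntegral.integral_eq_sub_of_hasDerivAt hd
    (Continuous.intervalIntegrable (by unfold circlePoint; fun_prop) _ _)]
  simp

end Arcs

section CurvesInEuc

open InnerProductGeometry

variable {n : ℕ} {Λ : ℝ}

theorem isArc_self (hn : 2 ≤ n) (hΛ : 0 < Λ) (f : ℝ → Euc n) (a : ℝ) : IsArc Λ f a a := by
  refine ⟨by rw [sub_self]; positivity, f a - Λ⁻¹ • EuclideanSpace.single ⟨0, by omega⟩ 1,
    EuclideanSpace.single ⟨0, by omega⟩ 1, EuclideanSpace.single ⟨1, by omega⟩ 1, a, by simp,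
    by simp, by simp [EuclideanSpace.inner_single_left], fun s hs => ?_⟩
  obtain rfl : s = a := le_antisymm hs.2 hs.1
  simp

theorem IsArc.reverse {f : ℝ → Euc n} {L a b : ℝ} (h : IsArc Λ (fun s => f (L - s)) a b) :
    IsArc Λ f (L - b) (L - a) := by
  obtain ⟨hlen, o, u, e, s₁, hu, he, hue, h⟩ := h
  refine ⟨by linarith, o, u, -e, L - s₁, hu, by rwa [norm_neg],
    by rw [inner_neg_right, hue, neg_zero], fun s hs => ?_⟩
  have := h (L - s) ⟨by linarith [hs.2], by linarith [hs.1]⟩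
  simp only [sub_sub_cancel] at this
  rw [this, show Λ * (s - (L - s₁)) = -(Λ * (L - s - s₁)) by ring, Real.cos_neg, Real.sin_neg]
  simp

theorem exists_right_arc (hn : 2 ≤ n) (hΛ : 0 < Λ) {T f : ℝ → Euc n} (hT : IsTangent Λ T)
    {x y z : ℝ} (h : IsShortest Λ T x z) (hxy : x < y) (hyz : y ≤ z) {e : Euc n}
    (he : ∀ t ∈ Icc x y, T t = e)
    (hf : ∀ s ∈ Icc x z, ∀ t ∈ Icc x z, f t - f s = ∫ r in s..t, T r) :
    ∃ d b, y ≤ d ∧ d ≤ b ∧ b ≤ z ∧ (∀ t ∈ Icc x d, T t = e) ∧ IsArc Λ f d b ∧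
      (b = z ∨ Real.pi / Λ ≤ b - d) := by
  by_cases hall : ∀ t ∈ Icc x z, T t = e
  · exact ⟨z, z, hyz, le_rfl, le_rfl, hall, isArc_self hn hΛ f z, Or.inl rfl⟩
  push Not at hall
  set B := {t ∈ Icc x z | T t ≠ e} with hB
  have hBy : ∀ t ∈ B, y ≤ t := fun t ht => by
    by_contra! hlt
    exact ht.2 (he t ⟨ht.1.1, hlt.le⟩)
  have hBbdd : BddBelow B := ⟨y, hBy⟩
  set d := sInf B with hd
  have hyd : y ≤ d := le_csInf hall hBy
  have hxd : x < d := hxy.trans_le hyd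
  obtain ⟨t₀, ht₀⟩ : B.Nonempty := hall
  have hdt₀ : d ≤ t₀ := csInf_le hBbdd ht₀
  have hed : ∀ t ∈ Icc x d, T t = e := by
    have hEq : EqOn T (fun _ => e) (Ico x d) := fun t ht => by
      by_contra hne
      exact ht.2.not_ge (csInf_le hBbdd ⟨⟨ht.1, ht.2.le.trans (hdt₀.trans ht₀.1.2)⟩, hne⟩)
    have := hEq.closure hT.continuous continuous_const
    rwa [closure_Ico hxd.ne] at this
  have hdB : ∀ t ∈ B, d < t := fun t ht =>
    (csInf_le hBbdd ht).lt_of_ne fun heq => ht.2 (hed t ⟨ht.1.1, heq.ge⟩)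
  have hdz : d < z := (hdB t₀ ht₀).trans_le ht₀.1.2
  obtain ⟨u, hu, heu, hTu⟩ := h.exists_eq_circlePoint hΛ hT hxd hed hdz fun t ht => by
    obtain ⟨s, hs, hst⟩ := exists_lt_of_csInf_lt ⟨t₀, ht₀⟩ ht
    exact ⟨s, ⟨hdB s hs, hst⟩, hs.2⟩
  have hpi : 0 < Real.pi / Λ := by positivity
  refine ⟨d, min z (d + Real.pi / Λ), hyd, le_min hdz.le (by linarith), min_le_left _ _, hed,
    ⟨?_, f d + Λ⁻¹ • u, -u, e, d, by rwa [norm_neg], ?_, ?_, fun s hs => ?_⟩, ?_⟩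
  · have := min_le_right z (d + Real.pi / Λ)
    rw [mul_div_assoc]
    linarith
  · rw [← hed d ⟨hxd.le, le_rfl⟩]; exact hT.unit d
  · rw [inner_neg_left, real_inner_comm, heu, neg_zero]
  · have h1 := hf d ⟨hxd.le, hdz.le⟩ s ⟨hxd.le.trans hs.1, hs.2.trans (min_le_left _ _)⟩
    rw [intervalIntegral.integral_congr (g := fun t => circlePoint e u (Λ * (t - d)))
      (fun t ht => hTu t (by
        rw [uIcc_of_le hs.1] at ht
        exact ⟨ht.1, ht.2.trans hs.2⟩)), integral_circlePoint hΛ.ne', sub_eq_iff_eq_add] at h1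
    rw [h1]
    module
  · rcases min_choice z (d + Real.pi / Λ) with hmin | hmin
    · exact Or.inl hmin
    · exact Or.inr (by rw [hmin]; linarith)

theorem exists_left_arc (hn : 2 ≤ n) (hΛ : 0 < Λ) {T f : ℝ → Euc n} (hT : IsTangent Λ T)
    {x y z : ℝ} (h : IsShortest Λ T z y) (hxy : x < y) (hzx : z ≤ x) {e : Euc n}
    (he : ∀ t ∈ Icc x y, T t = e)
    (hf : ∀ s ∈ Icc z y, ∀ t ∈ Icc z y, f t - f s = ∫ r in s..t, T r) :
    ∃ a c, z ≤ a ∧ a ≤ c ∧ c ≤ x ∧ (∀ t ∈ Icc c y, T t = e) ∧ IsArc Λ f a c ∧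
      (a = z ∨ Real.pi / Λ ≤ c - a) := by
  obtain ⟨d, b, hd, hdb, hb, hed, harc, hlen⟩ := exists_right_arc hn hΛ (hT.reverse 0)
    (f := fun s => f (0 - s)) (h.reverse (L := 0)) (sub_lt_sub_left hxy 0) (sub_le_sub_left hzx 0)
    (e := -e) (fun t ht => by rw [he _ ⟨by linarith [ht.2], by linarith [ht.1]⟩])
    (fun s hs t ht => by
      rw [hf (0 - s) ⟨by linarith [hs.2], by linarith [hs.1]⟩ (0 - t)
        ⟨by linarith [ht.2], by linarith [ht.1]⟩, intervalIntegral.integral_neg,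
        intervalIntegral.integral_comp_sub_left T, intervalIntegral.integral_symm])
  refine ⟨0 - b, 0 - d, by linarith, by linarith, by linarith, fun t ht => ?_, harc.reverse, ?_⟩
  · have := hed (0 - t) ⟨by linarith [ht.2], by linarith [ht.1]⟩
    simpa using this
  · rcases hlen with rfl | hlen
    · exact Or.inl (by ring)
    · exact Or.inr (by linarith)

theorem isTangent_projIcc {g : ℝ → Euc n} {a b K : ℝ} (hab : a ≤ b) (hK : 0 ≤ K)
    (hlip : ∀ x ∈ Icc a b, ∀ y ∈ Icc a b, ‖g x - g y‖ ≤ K * |x - y|)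
    (hunit : ∀ x ∈ Icc a b, ‖g x‖ = 1) : IsTangent K fun t => g (projIcc a b hab t) := by
  refine ⟨fun x y => (hlip _ (projIcc a b hab x).2 _ (projIcc a b hab y).2).trans ?_,
    fun x => hunit _ (projIcc a b hab x).2⟩
  exact mul_le_mul_of_nonneg_left (abs_projIcc_sub_projIcc hab) hK

variable {p q v w : Euc n}

/-- The tangent field of a curve in `C(p, q; v, w; Λ)`, extended by constants to all of `ℝ`. -/
noncomputable def CurveCC.tangent (γ : CurveCC n p q v w Λ) (t : ℝ) : Euc n := γ.fd (projIcc 0 γ.L γ.Lnn t)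

theorem CurveCC.tangent_eq (γ : CurveCC n p q v w Λ) {t : ℝ} (ht : t ∈ Icc 0 γ.L) :
    γ.tangent t = γ.fd t := by
  rw [CurveCC.tangent, projIcc_of_mem γ.Lnn ht]

theorem CurveCC.isTangent (γ : CurveCC n p q v w Λ) (hΛ : 0 < Λ) : IsTangent Λ γ.tangent :=
  isTangent_projIcc γ.Lnn hΛ.le (fun x hx y hy => by
    have := γ.lip.dist_le_mul x hx y hy
    rwa [dist_eq_norm, Real.dist_eq, Real.coe_toNNReal _ hΛ.le] at this) γ.unit

theorem CurveCC.sub_eq_integral (γ : CurveCC n p q v w Λ) (hΛ : 0 < Λ) :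
    ∀ s ∈ Icc 0 γ.L, ∀ t ∈ Icc 0 γ.L, γ.f t - γ.f s = ∫ r in s..t, γ.tangent r := by
  have hT := γ.isTangent hΛ
  have h0 : ∀ t ∈ Icc 0 γ.L, γ.f t - γ.f 0 = ∫ r in 0..t, γ.tangent r := by
    intro t ht
    refine (intervalIntegral.integral_eq_sub_of_hasDeriv_right_of_le ht.1
      (fun x hx => ((γ.deriv x ⟨hx.1, hx.2.trans ht.2⟩).continuousWithinAt).mono
        (Icc_subset_Icc_right ht.2)) (fun x hx => ?_) (hT.intervalIntegrable _ _)).symm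
    have hx' : x ∈ Ioo 0 γ.L := ⟨hx.1, hx.2.trans_le ht.2⟩
    rw [γ.tangent_eq (Ioo_subset_Icc_self hx')]
    exact ((γ.deriv x (Ioo_subset_Icc_self hx')).hasDerivAt
      (Icc_mem_nhds hx'.1 hx'.2)).hasDerivWithinAt
  intro s hs t ht
  rw [← intervalIntegral.integral_interval_sub_left (hT.intervalIntegrable 0 t)
    (hT.intervalIntegrable 0 s), ← h0 s hs, ← h0 t ht, sub_sub_sub_cancel_right]

/-- The curve starting at `p` with a given tangent field. -/
noncomputable def CurveCC.ofTangent {T : ℝ → Euc n} (hT : IsTangent Λ T) {ℓ : ℝ} (hℓ : 0 ≤ ℓ)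
    (h0 : T 0 = v) (hℓT : T ℓ = w) (hpq : p + ∫ t in (0 : ℝ)..ℓ, T t = q) :
    CurveCC n p q v w Λ where
  L := ℓ
  Lnn := hℓ
  f s := p + ∫ t in (0 : ℝ)..s, T t
  fd := T
  deriv s _ :=
    ((hT.continuous.integral_hasStrictDerivAt 0 s).hasDerivAt.const_add p).hasDerivWithinAt
  unit s _ := hT.unit s
  lip := (LipschitzWith.of_dist_le' fun x y => by
    simpa [dist_eq_norm, Real.norm_eq_abs] using hT.lip x y).lipschitzOnWith
  i0 := by simp
  id0 := h0
  iL := hpq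
  idL := hℓT

theorem CurveCC.isShortest (γ : CurveCC n p q v w Λ) (hΛ : 0 < Λ)
    (hmin : ∀ η : CurveCC n p q v w Λ, γ.L ≤ η.L) : IsShortest Λ γ.tangent 0 γ.L := by
  rintro ℓ ⟨hℓ, S, hS, hS0, hSℓ, hSi⟩
  rw [sub_zero]
  refine hmin (CurveCC.ofTangent hS hℓ ?_ ?_ ?_)
  · rw [hS0, γ.tangent_eq ⟨le_rfl, γ.Lnn⟩, γ.id0]
  · rw [hSℓ, γ.tangent_eq ⟨γ.Lnn, le_rfl⟩, γ.idL]
  · rw [hSi, ← γ.sub_eq_integral hΛ 0 ⟨le_rfl, γ.Lnn⟩ γ.L ⟨γ.Lnn, le_rfl⟩, γ.i0, γ.iL]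
    abel

theorem CurveCC.exists_eqOn_of_curvLt (γ : CurveCC n p q v w Λ) (hΛ : 0 < Λ)
    (hmin : ∀ η : CurveCC n p q v w Λ, γ.L ≤ η.L) (hL : 0 < γ.L) {s₀ : ℝ}
    (hs₀ : s₀ ∈ Icc 0 γ.L) (hlt : CurvLt γ.fd (Icc 0 γ.L) s₀ Λ) :
    ∃ a b, 0 ≤ a ∧ a < b ∧ b ≤ γ.L ∧ s₀ ∈ Icc a b ∧ ∀ t ∈ Icc a b, γ.tangent t = γ.tangent a := by
  obtain ⟨δ, hδ, Λ', hΛ', hang⟩ := hlt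
  set a := max 0 (s₀ - δ / 2) with ha
  set b := min γ.L (s₀ + δ / 2) with hb
  have has : a ≤ s₀ := max_le hs₀.1 (by linarith)
  have hsb : s₀ ≤ b := le_min hs₀.2 (by linarith)
  have ha0 : 0 ≤ a := le_max_left _ _
  have hbL : b ≤ γ.L := min_le_left _ _
  have hab : a < b := max_lt (lt_min hL (by linarith [hs₀.1]))
    (lt_min (by linarith [hs₀.2]) (by linarith))
  refine ⟨a, b, ha0, hab, hbL, ⟨has, hsb⟩, ?_⟩
  have hdist : ∀ x ∈ Icc a b, |x - s₀| < δ := fun x hx => by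
    rw [abs_lt]
    constructor <;> linarith [hx.1, hx.2, le_max_right 0 (s₀ - δ / 2),
      min_le_right γ.L (s₀ + δ / 2)]
  have hT := γ.isTangent hΛ
  have hS : IsTangent (max Λ' 0) fun t => γ.tangent (projIcc a b hab.le t) := by
    refine isTangent_projIcc hab.le (le_max_right _ _) (fun x hx y hy => ?_)
      fun x _ => hT.unit x
    rcases eq_or_ne x y with rfl | hxy
    · simp
    have hx' : x ∈ Icc 0 γ.L := ⟨ha0.trans hx.1, hx.2.trans hbL⟩
    have hy' : y ∈ Icc 0 γ.L := ⟨ha0.trans hy.1, hy.2.trans hbL⟩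
    refine (norm_sub_le_angle (hT.unit x) (hT.unit y)).trans ?_
    rw [γ.tangent_eq hx', γ.tangent_eq hy']
    refine (hang x hx' y hy' hxy (hdist x hx) (hdist y hy)).trans ?_
    gcongr
    exact le_max_left _ _
  have hST : ∀ t ∈ Icc a b, γ.tangent (projIcc a b hab.le t) = γ.tangent t := fun t ht => by
    rw [projIcc_of_mem hab.le ht]
  have hsh : IsShortest Λ (fun t => γ.tangent (projIcc a b hab.le t)) a b := by
    intro ℓ hℓ
    refine (γ.isShortest hΛ hmin).mono hT ha0 hab.le hbL ℓ ?_
    beta_reduce at hℓ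
    rwa [hST a ⟨le_rfl, hab.le⟩, hST b ⟨hab.le, le_rfl⟩, intervalIntegral.integral_congr
      (g := γ.tangent) fun t ht => hST t (by rwa [uIcc_of_le hab.le] at ht)] at hℓ
  intro t ht
  have := hsh.eq_left_of_slack (max_lt hΛ' hΛ) hS hab t ht
  rwa [hST t ht, hST a ⟨le_rfl, hab.le⟩] at this

end CurvesInEuc

/-- A length-minimizer in `C(p,q;v,w;Λ)` whose curvature is `< Λ` at some
`s₀` contains a `CLC(Λ)` piece `γ|[a₀,b₀]` around `s₀`, whose circular parts have length at
least `π/Λ` unless they contain an endpoint of `γ`. -/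
theorem statement_0 {n : ℕ} (hn : 2 ≤ n) (p q v w : Euc n)
    (hv : ‖v‖ = 1) (hw : ‖w‖ = 1) (Λ : ℝ) (hΛ : 0 < Λ)
    (γ : CurveCC n p q v w Λ)
    (hmin : ∀ η : CurveCC n p q v w Λ, γ.L ≤ η.L)
    (s₀ : ℝ) (hs₀ : s₀ ∈ Set.Icc (0 : ℝ) γ.L)
    (hlt : CurvLt γ.fd (Set.Icc 0 γ.L) s₀ Λ) :
    ∃ a₀ c d b₀ : ℝ,
      0 ≤ a₀ ∧ a₀ ≤ c ∧ c ≤ d ∧ d ≤ b₀ ∧ b₀ ≤ γ.L ∧ s₀ ∈ Set.Icc a₀ b₀ ∧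
      (∀ s ∈ Set.Icc c d, γ.fd s = γ.fd c) ∧
      IsArc Λ γ.f a₀ c ∧ IsArc Λ γ.f d b₀ ∧
      (a₀ = 0 ∨ Real.pi / Λ ≤ c - a₀) ∧
      (b₀ = γ.L ∨ Real.pi / Λ ≤ b₀ - d) := by
  rcases γ.Lnn.eq_or_lt with hL | hL
  · obtain rfl : s₀ = 0 := le_antisymm (hL ▸ hs₀.2) hs₀.1
    exact ⟨0, 0, 0, 0, le_rfl, le_rfl, le_rfl, le_rfl, γ.Lnn, ⟨le_rfl, le_rfl⟩,
      fun s hs => by rw [le_antisymm hs.2 hs.1], isArc_self hn hΛ γ.f 0, isArc_self hn hΛ γ.f 0,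
      Or.inl rfl, Or.inl hL⟩
  obtain ⟨a, b, ha, hab, hb, hs₀ab, hconst⟩ := γ.exists_eqOn_of_curvLt hΛ hmin hL hs₀ hlt
  have hT := γ.isTangent hΛ
  have hsh := γ.isShortest hΛ hmin
  have hf := γ.sub_eq_integral hΛ
  obtain ⟨a₀, c, ha₀, ha₀c, hca, hTc, harc₁, hlen₁⟩ := exists_left_arc hn hΛ hT (f := γ.f)
    (hsh.mono hT le_rfl (ha.trans hab.le) hb) hab ha hconst fun s hs t ht =>
      hf s ⟨hs.1, hs.2.trans hb⟩ t ⟨ht.1, ht.2.trans hb⟩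
  obtain ⟨d, b₀, hbd, hdb₀, hb₀, hTd, harc₂, hlen₂⟩ := exists_right_arc hn hΛ hT (f := γ.f)
    (hsh.mono hT ha (hab.le.trans hb) le_rfl) hab hb hconst fun s hs t ht =>
      hf s ⟨ha.trans hs.1, hs.2⟩ t ⟨ha.trans ht.1, ht.2⟩
  have hTe : ∀ t ∈ Icc c d, γ.fd t = γ.tangent a := fun t ht => by
    rw [← γ.tangent_eq ⟨(ha₀.trans ha₀c).trans ht.1, (ht.2.trans hdb₀).trans hb₀⟩]
    rcases le_total t b with htb | htb
    · exact hTc t ⟨ht.1, htb⟩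
    · exact hTd t ⟨hab.le.trans htb, ht.2⟩
  have hcd : c ≤ d := by linarith
  refine ⟨a₀, c, d, b₀, ha₀, ha₀c, hcd, hdb₀, hb₀, ⟨by linarith [hs₀ab.1], by linarith [hs₀ab.2]⟩,
    fun s hs => by rw [hTe s hs, hTe c ⟨le_rfl, hcd⟩], harc₁, harc₂, hlen₁, hlen₂⟩
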